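/- Let T be a complete arithmetically definable theory in a countable arithmetically definable language with no finite models. Then the following are equivalent: (1) T is arithmetically stable; (2) for every arithmetically extendible model M ⊨ T and every arithmetical set A ⊆ M, there is an arithmetically extendible elementary extension M ≼ N ⊨ T which realizes every arithmetic n-type over A inside M, for every n ≥ 1. -/

import Mathlib

open FirstOrder FirstOrder.Language

namespace ArMorley

/-! ## Arithmetical sets and arithmetic reducibility -/

/-- Function symbols of the language of arithmetic: `0`, `1`, `+`, `·`. -/
inductive ArFunc : ℕ → Type
  | zero : ArFunc 0
  | one : ArFunc 0
  | add : ArFunc 2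
  | mul : ArFunc 2

/-- Relation symbols: `<` and a unary oracle predicate. -/
inductive ArRel : ℕ → Type
  | lt : ArRel 2
  | mem : ArRel 1

/-- The language `(+, ·, 0, 1, <, Y)` of arithmetic with a unary oracle predicate. -/
def arithLang : FirstOrder.Language := ⟨ArFunc, ArRel⟩

/-- The standard structure on `ℕ`, with the oracle predicate interpreted by `Y`. -/
def arithStructure (Y : Set ℕ) : arithLang.Structure ℕ where
  funMap := fun {n} f =>
    match f with
    | ArFunc.zero => fun _ => 0
    | ArFunc.one => fun _ => 1
    | ArFunc.add => fun v => v 0 + v 1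
    | ArFunc.mul => fun v => v 0 * v 1
  RelMap := fun {n} r =>
    match r with
    | ArRel.lt => fun v => v 0 < v 1
    | ArRel.mem => fun v => v 0 ∈ Y

/-- `X ≤_ar Y` : `X` is definable without parameters in `(ℕ, +, ·, 0, 1, <, Y)`. -/
def ArReducible (X Y : Set ℕ) : Prop :=
  letI := arithStructure Y
  ∃ φ : arithLang.Formula (Fin 1), X = { n : ℕ | φ.Realize (fun _ => n) }

/-- `X` is arithmetical: definable without parameters in `(ℕ, +, ·, 0, 1, <)`. -/
def IsArithmetical (X : Set ℕ) : Prop := ArReducible X ∅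

/-- `X` and `Y` have the same arithmetic degree. -/
def ArEquiv (X Y : Set ℕ) : Prop := ArReducible X Y ∧ ArReducible Y X

/-! ## Coding conventions -/

/-- Code of a list of naturals. -/
def listCode (l : List ℕ) : ℕ := Encodable.encode l

/-- Code of a finite tuple of naturals. -/
def tupleCode {n : ℕ} (v : Fin n → ℕ) : ℕ := listCode (List.ofFn v)

/-- The subset of `ℕ` corresponding to a set of elements of a coded domain. -/
def subCode {A : Set ℕ} (S : Set ↥A) : Set ℕ := Subtype.val '' S

/-- Code of a set of `n`-tuples from a coded domain as a subset of `ℕ`. -/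
def tupleSetCode {A : Set ℕ} {n : ℕ} (X : Set (Fin n → ↥A)) : Set ℕ :=
  { c : ℕ | ∃ v ∈ X, c = tupleCode (fun i => ((v i : ℕ))) }

/-- Code of the graph of a function between coded domains. -/
def graphCode {A B : Set ℕ} (f : ↥A → ↥B) : Set ℕ :=
  { c : ℕ | ∃ a : ↥A, c = Nat.pair (a : ℕ) ((f a : ℕ)) }

/-! ## Gödel coded languages -/

/-- A fixed Gödel coding of the symbols of a countable first-order language. -/
structure GoedelCoding (L : FirstOrder.Language) where
  encFun : ∀ n, L.Functions n → ℕ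
  encFun_inj : ∀ n, Function.Injective (encFun n)
  encRel : ∀ n, L.Relations n → ℕ
  encRel_inj : ∀ n, Function.Injective (encRel n)

variable {L : FirstOrder.Language}

/-- The set of codes of the symbols of `L`. -/
def symbolCodes (g : GoedelCoding L) : Set ℕ :=
  { c | (∃ (n : ℕ) (f : L.Functions n), c = Nat.pair 0 (Nat.pair n (g.encFun n f))) ∨
        (∃ (n : ℕ) (R : L.Relations n), c = Nat.pair 1 (Nat.pair n (g.encRel n R))) }

/-- `L` is an arithmetically definable language. -/
def ArithLang (g : GoedelCoding L) : Prop := IsArithmetical (symbolCodes g)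

/-- Code of a term, with a given coding of the variables. -/
def termCode (g : GoedelCoding L) {α : Type} (encα : α → ℕ) (t : L.Term α) : ℕ :=
  listCode (t.listEncode.map (Sum.elim (fun a => Nat.pair 0 (encα a))
    (fun p => Nat.pair 1 (Nat.pair p.1 (g.encFun p.1 p.2)))))

/-- Code of a (bounded) formula, with a given coding of free variables. -/
def formulaCode (g : GoedelCoding L) {α : Type} (encα : α → ℕ) {n : ℕ}
    (φ : L.BoundedFormula α n) : ℕ :=
  listCode (φ.listEncode.map (Sum.elim
    (fun p => Nat.pair 0 (Nat.pair p.1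
      (termCode g (Sum.elim (fun a => Nat.pair 0 (encα a)) (fun i => Nat.pair 1 i.1)) p.2)))
    (Sum.elim
      (fun q => Nat.pair 1 (Nat.pair q.1 (g.encRel q.1 q.2)))
      (fun m => Nat.pair 2 m))))

/-- Code of a sentence. -/
def sentenceCode (g : GoedelCoding L) (φ : L.Sentence) : ℕ :=
  formulaCode g (fun a : Empty => a.elim) φ

/-- The set of codes of the axioms of a theory. -/
def theoryCode (g : GoedelCoding L) (T : L.Theory) : Set ℕ :=
  { c | ∃ φ ∈ T, c = sentenceCode g φ }

/-- `T` is an arithmetically definable theory. -/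
def ArithTheory (g : GoedelCoding L) (T : L.Theory) : Prop := IsArithmetical (theoryCode g T)

/-! ## Coded structures -/

/-- A coded `L`-structure: an `L`-structure whose domain is a subset of `ℕ`
with infinite complement. -/
structure CodedStructure (L : FirstOrder.Language) where
  carrier : Set ℕ
  compl_infinite : (carrierᶜ : Set ℕ).Infinite
  struc : L.Structure ↥carrier

/-- A coded structure is a model of `T`. -/
def CodedStructure.Models (M : CodedStructure L) (T : L.Theory) : Prop :=
  ∀ φ ∈ T, @Sentence.Realize L ↥M.carrier M.struc φ

/-- The (coded) elementary diagram of a coded structure. -/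
def elemDiagram (g : GoedelCoding L) (M : CodedStructure L) : Set ℕ :=
  { c | ∃ (k : ℕ) (φ : L.Formula (Fin k)) (a : Fin k → ↥M.carrier),
      c = Nat.pair (Nat.pair k (formulaCode g Fin.val φ)) (tupleCode fun i => ((a i : ℕ))) ∧
      (letI := M.struc; φ.Realize a) }

/-- A coded structure is arithmetically decidable if its elementary diagram is arithmetical. -/
def ArithDecidable (g : GoedelCoding L) (M : CodedStructure L) : Prop :=
  IsArithmetical (elemDiagram g M)

/-- `M ≼ N` for coded structures: `M`'s domain is contained in `N`'s, and the
inclusion is elementary. -/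
structure ElemSub (M N : CodedStructure L) : Prop where
  subset : M.carrier ⊆ N.carrier
  elem : ∀ (k : ℕ) (φ : L.Formula (Fin k)) (a : Fin k → ↥M.carrier),
    (letI := M.struc; φ.Realize a) ↔
      (letI := N.struc; φ.Realize (fun i => (⟨((a i : ℕ)), subset (a i).2⟩ : ↥N.carrier)))

/-- A coded model of `T` is arithmetically extendible if it is an elementary substructure of
an arithmetically decidable coded model of `T`. -/
def ArithExtendible (g : GoedelCoding L) (T : L.Theory) (M : CodedStructure L) : Prop :=
  ∃ N : CodedStructure L, ArithDecidable g N ∧ N.Models T ∧ ElemSub M N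

/-! ## Model-theoretic notions in arbitrary structures -/

/-- `N` (with structure `SN`) is a model of `T`. -/
def ModelsT (L : FirstOrder.Language) (T : L.Theory) (N : Type) (SN : L.Structure N) : Prop :=
  ∀ φ ∈ T, @Sentence.Realize L N SN φ

/-- `T` has no finite models. -/
def NoFiniteModels (L : FirstOrder.Language) (T : L.Theory) : Prop :=
  ∀ (N : Type) (SN : L.Structure N), ModelsT L T N SN → Infinite N

/-- Elementary embeddings, with the structures given explicitly. -/
def EEmb (L : FirstOrder.Language) (M : Type) (SM : L.Structure M)
    (N : Type) (SN : L.Structure N) : Type _ :=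
  @FirstOrder.Language.ElementaryEmbedding L M N SM SN

/-- The underlying map of an elementary embedding. -/
def EEmb.fn {L : FirstOrder.Language} {M : Type} {SM : L.Structure M}
    {N : Type} {SN : L.Structure N} (j : EEmb L M SM N SN) : M → N :=
  @FirstOrder.Language.ElementaryEmbedding.toFun L M N SM SN j

/-- A subset of `N^n` definable with parameters from `P`. -/
def DefinableOverT (L : FirstOrder.Language) (N : Type) (SN : L.Structure N) (P : Set N)
    {n : ℕ} (X : Set (Fin n → N)) : Prop :=
  letI := SN
  ∃ (m : ℕ) (ψ : L.Formula (Fin n ⊕ Fin m)) (b : Fin m → N),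
    (∀ i, b i ∈ P) ∧ X = { v | ψ.Realize (Sum.elim v b) }

/-- A subset of `N` definable with (arbitrary) parameters. -/
def Definable1 (L : FirstOrder.Language) (N : Type) (SN : L.Structure N) (Y : Set N) : Prop :=
  letI := SN
  ∃ (m : ℕ) (ψ : L.Formula (Fin 1 ⊕ Fin m)) (b : Fin m → N),
    Y = { x : N | ψ.Realize (Sum.elim (fun _ => x) b) }

/-- The algebraic closure of `B` in `N`: elements satisfying a formula with parameters
from `B` having finitely many solutions. -/
def aclIn (L : FirstOrder.Language) (N : Type) (SN : L.Structure N) (B : Set N) : Set N :=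
  letI := SN
  { a : N | ∃ (k : ℕ) (φ : L.Formula (Fin 1 ⊕ Fin k)) (b : Fin k → N),
      (∀ i, b i ∈ B) ∧ φ.Realize (Sum.elim (fun _ => a) b) ∧
      { x : N | φ.Realize (Sum.elim (fun _ => x) b) }.Finite }

/-- The domain of the substructure of `N` generated by `B`: values of terms at
arguments from `B`. -/
def genSub (L : FirstOrder.Language) (N : Type) (SN : L.Structure N) (B : Set N) : Set N :=
  letI := SN
  { a : N | ∃ (t : L.Term ℕ) (v : ℕ → N), (∀ i, v i ∈ B) ∧ a = t.realize v }

/-- The set defined by a formula `φ(x, p̄)` in one free variable with parameters `p̄`. -/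
def smSet (L : FirstOrder.Language) (N : Type) (SN : L.Structure N) {k : ℕ}
    (φ : L.Formula (Fin 1 ⊕ Fin k)) (p : Fin k → N) : Set N :=
  letI := SN
  { x : N | φ.Realize (Sum.elim (fun _ => x) p) }

/-- A definable tuple-set in a coded structure, with parameters from `P`. -/
def DefinableOver (M : CodedStructure L) (P : Set ↥M.carrier) {n : ℕ}
    (X : Set (Fin n → ↥M.carrier)) : Prop :=
  DefinableOverT L ↥M.carrier M.struc P X

/-- A definable tuple-set in a coded structure, with arbitrary parameters. -/
def DefinableIn (M : CodedStructure L) {n : ℕ} (X : Set (Fin n → ↥M.carrier)) : Prop :=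
  DefinableOver M Set.univ X

/-! ## Isomorphisms of coded structures and `D`-categoricity -/

/-- An isomorphism of coded `L`-structures. -/
structure CodedIso (M N : CodedStructure L) where
  toFun : ↥M.carrier → ↥N.carrier
  invFun : ↥N.carrier → ↥M.carrier
  left_inv : Function.LeftInverse invFun toFun
  right_inv : Function.RightInverse invFun toFun
  map_fun : ∀ {k : ℕ} (f : L.Functions k) (v : Fin k → ↥M.carrier),
    toFun (M.struc.funMap f v) = N.struc.funMap f (toFun ∘ v)
  map_rel : ∀ {k : ℕ} (r : L.Relations k) (v : Fin k → ↥M.carrier),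
    M.struc.RelMap r v ↔ N.struc.RelMap r (toFun ∘ v)

/-- `f` is a `D`-preserving isomorphism, where `d` is a representative of the
arithmetic degree `D`. -/
def DPreserving (d : Set ℕ) {M N : CodedStructure L} (f : CodedIso M N) : Prop :=
  ArReducible (graphCode f.toFun) d ∧
  ArReducible (graphCode f.invFun) d ∧
  (∀ (n : ℕ) (X : Set (Fin n → ↥M.carrier)), DefinableIn M X →
      ArEquiv (tupleSetCode X) d →
      ArEquiv (tupleSetCode ((fun v => f.toFun ∘ v) '' X)) d) ∧
  (∀ (n : ℕ) (Y : Set (Fin n → ↥N.carrier)), DefinableIn N Y →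
      ArEquiv (tupleSetCode Y) d →
      ArEquiv (tupleSetCode ((fun v => f.invFun ∘ v) '' Y)) d)

/-- `T` is `D`-categorical, where `d` is a representative of the nonzero
arithmetic degree `D`. -/
def DCategorical (g : GoedelCoding L) (T : L.Theory) (d : Set ℕ) : Prop :=
  ∀ M₀ M₁ M₂ : CodedStructure L,
    ArithDecidable g M₀ → M₀.Models T →
    M₁.Models T → ArithExtendible g T M₁ →
    M₂.Models T → ArithExtendible g T M₂ →
    ElemSub M₀ M₁ → ElemSub M₀ M₂ →
    ArEquiv M₁.carrier d → ArEquiv M₂.carrier d →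
    ∃ f : CodedIso M₁ M₂, DPreserving d f ∧
      ∀ (x : ℕ) (hx : x ∈ M₀.carrier) (h₁ : x ∈ M₁.carrier),
        ((f.toFun ⟨x, h₁⟩ : ℕ)) = x

/-! ## Vaughtian pairs, prime models, strong minimality -/

/-- `T` has a Vaughtian pair. -/
def HasVaughtianPair (T : L.Theory) : Prop :=
  ∃ (N : Type) (SN : L.Structure N),
    ModelsT L T N SN ∧
    ∃ S : @FirstOrder.Language.ElementarySubstructure L N SN,
      ((S.toSubstructure : Set N) ≠ Set.univ ∧
      ∃ (k : ℕ) (φ : L.Formula (Fin 1 ⊕ Fin k)) (a : Fin k → N),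
        (∀ i, a i ∈ (S.toSubstructure : Set N)) ∧
        smSet L N SN φ a ⊆ (S.toSubstructure : Set N) ∧
        (smSet L N SN φ a).Infinite)

/-- A coded model of `T` is prime: it elementarily embeds into every model of `T`. -/
def PrimeModel (L : FirstOrder.Language) (T : L.Theory) (P : CodedStructure L) : Prop :=
  P.Models T ∧ ∀ (N : Type) (SN : L.Structure N), ModelsT L T N SN →
    Nonempty (EEmb L ↥P.carrier P.struc N SN)

/-- `φ(x, p̄)` is strongly minimal over the coded model `M`: its solution set in `M` is
infinite, and in every elementary extension of `M` modelling `T` every definable subset of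
its solution set is finite or cofinite in it. -/
def StronglyMinimalOver (T : L.Theory) (M : CodedStructure L) {k : ℕ}
    (φ : L.Formula (Fin 1 ⊕ Fin k)) (p : Fin k → ↥M.carrier) : Prop :=
  (smSet L ↥M.carrier M.struc φ p).Infinite ∧
  ∀ (N : Type) (SN : L.Structure N), ModelsT L T N SN →
    ∀ j : EEmb L ↥M.carrier M.struc N SN,
      ∀ Y : Set N, Definable1 L N SN Y →
        Y ⊆ smSet L N SN φ (fun i => j.fn (p i)) →
        (Y.Finite ∨ ((smSet L N SN φ (fun i => j.fn (p i))) \ Y).Finite)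

/-- `T` is a strongly minimal theory: every model is infinite, and every
parameter-definable subset of any model is finite or cofinite. -/
def StronglyMinimalTheory (L : FirstOrder.Language) (T : L.Theory) : Prop :=
  (∀ (N : Type) (SN : L.Structure N), ModelsT L T N SN → Infinite N) ∧
  (∀ (N : Type) (SN : L.Structure N), ModelsT L T N SN →
    ∀ Y : Set N, Definable1 L N SN Y → (Y.Finite ∨ (Yᶜ : Set N).Finite))

/-- The structural control clause: an arithmetically decidable prime model together with
a strongly minimal formula over it generating every elementary extension. -/
def GeneratesAll (T : L.Theory) (P : CodedStructure L) {k : ℕ}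
    (φ : L.Formula (Fin 1 ⊕ Fin k)) (p : Fin k → ↥P.carrier) : Prop :=
  ∀ (N : Type) (SN : L.Structure N), ModelsT L T N SN →
    ∀ j : EEmb L ↥P.carrier P.struc N SN,
      aclIn L N SN (Set.range j.fn ∪ smSet L N SN φ (fun i => j.fn (p i))) = Set.univ

/-- Clause (3) of the arithmetic Baldwin–Lachlan theorem. -/
def SMControl (g : GoedelCoding L) (T : L.Theory) : Prop :=
  ∃ (P : CodedStructure L), ArithDecidable g P ∧ PrimeModel L T P ∧
    ∃ (k : ℕ) (φ : L.Formula (Fin 1 ⊕ Fin k)) (p : Fin k → ↥P.carrier),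
      StronglyMinimalOver T P φ p ∧ GeneratesAll T P φ p

/-! ## Types and arithmetical stability -/

/-- A formula with a finite parameter tuple from a coded structure, in `n` object
variables. -/
def ParamFormula (L : FirstOrder.Language) (M : CodedStructure L) (n : ℕ) : Type :=
  Σ k : ℕ, L.Formula (Fin n ⊕ Fin k) × (Fin k → ↥M.carrier)

/-- All parameters of `q` lie in `A`. -/
def paramsIn {M : CodedStructure L} {n : ℕ} (A : Set ℕ) (q : ParamFormula L M n) : Prop :=
  ∀ i, ((q.2.2 i : ℕ)) ∈ A

/-- `p` is consistent with the elementary diagram of `M`: it is realized in some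
elementary extension of `M`. -/
def TypeConsistent (M : CodedStructure L) {n : ℕ} (p : Set (ParamFormula L M n)) : Prop :=
  ∃ (N : Type) (SN : L.Structure N) (j : EEmb L ↥M.carrier M.struc N SN) (b : Fin n → N),
    ∀ q ∈ p, letI := SN; q.2.1.Realize (Sum.elim b (fun i => j.fn (q.2.2 i)))

/-- `p` is a (complete) `n`-type over `A` inside `M`: a maximal set of formulas with
parameters from `A` consistent with the elementary diagram of `M`. -/
def IsNType (M : CodedStructure L) (A : Set ℕ) (n : ℕ)
    (p : Set (ParamFormula L M n)) : Prop :=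
  (∀ q ∈ p, paramsIn A q) ∧
  TypeConsistent M p ∧
  ∀ q : ParamFormula L M n, paramsIn A q → q ∉ p → ¬ TypeConsistent M (insert q p)

/-- The code of a formula-with-parameters. -/
def pfCode (g : GoedelCoding L) {M : CodedStructure L} {n : ℕ} (q : ParamFormula L M n) : ℕ :=
  Nat.pair
    (Nat.pair q.1 (formulaCode g
      (Sum.elim (fun i : Fin n => Nat.pair 0 i.1) (fun j : Fin q.1 => Nat.pair 1 j.1)) q.2.1))
    (tupleCode fun i => ((q.2.2 i : ℕ)))

/-- The set of codes of the formulas of `p`. -/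
def typeCode (g : GoedelCoding L) {M : CodedStructure L} {n : ℕ}
    (p : Set (ParamFormula L M n)) : Set ℕ :=
  { c | ∃ q ∈ p, c = pfCode g q }

/-- `p` is realized in the coded elementary extension `N` of `M`. -/
def RealizesType {M N : CodedStructure L} (h : M.carrier ⊆ N.carrier) {n : ℕ}
    (p : Set (ParamFormula L M n)) : Prop :=
  ∃ b : Fin n → ↥N.carrier, ∀ q ∈ p,
    letI := N.struc
    q.2.1.Realize (Sum.elim b (fun i => (⟨((q.2.2 i : ℕ)), h (q.2.2 i).2⟩ : ↥N.carrier)))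

/-- The `(n, i)`-th column of an effective join. -/
def tripleSection (X : Set ℕ) (n i : ℕ) : Set ℕ := { m | Nat.pair n (Nat.pair i m) ∈ X }

/-- `T` is arithmetically stable: over every arithmetically decidable model and every
arithmetical parameter set, the family of arithmetic `n`-types (for all `n ≥ 1`) has a
uniform arithmetical code in which every arithmetic `n`-type appears at least once. -/
def ArithStable (g : GoedelCoding L) (T : L.Theory) : Prop :=
  ∀ M : CodedStructure L, ArithDecidable g M → M.Models T →
    ∀ A : Set ℕ, A ⊆ M.carrier → IsArithmetical A →
      ∃ X : Set ℕ, IsArithmetical X ∧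
        (∀ n, 1 ≤ n → ∀ i : ℕ, ∃ p : Set (ParamFormula L M n),
            IsNType M A n p ∧ IsArithmetical (typeCode g p) ∧
            tripleSection X n i = typeCode g p) ∧
        (∀ n, 1 ≤ n → ∀ p : Set (ParamFormula L M n),
            IsNType M A n p → IsArithmetical (typeCode g p) →
            ∃ i : ℕ, tripleSection X n i = typeCode g p)

/-- The set of elements occurring as a coordinate of a tuple in `X`. -/
def coordSet {N : Type} {n : ℕ} (X : Set (Fin n → N)) : Set N :=
  { m | ∃ v ∈ X, ∃ i, v i = m }

/-! ## First-order definability over the standard model of arithmetic -/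

/-- A predicate on assignments of the variables `x₀, x₁, …` that is first-order definable in
the standard model of arithmetic. -/
def Dp (P : (ℕ → ℕ) → Prop) : Prop :=
  letI := arithStructure ∅
  ∃ φ : arithLang.Formula ℕ, ∀ v, φ.Realize v ↔ P v

namespace Dp

variable {P Q : (ℕ → ℕ) → Prop}

theorem congr (h : Dp P) (e : ∀ v, Q v ↔ P v) : Dp Q := by
  have : Q = P := funext fun v => propext (e v)
  exact this ▸ h

theorem not (h : Dp P) : Dp fun v => ¬ P v := by
  let _ := arithStructure ∅
  obtain ⟨φ, hφ⟩ := h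
  exact ⟨φ.not, fun v => by rw [Formula.realize_not, hφ]⟩

theorem and (h : Dp P) (k : Dp Q) : Dp fun v => P v ∧ Q v := by
  let _ := arithStructure ∅
  obtain ⟨φ, hφ⟩ := h
  obtain ⟨ψ, hψ⟩ := k
  exact ⟨φ ⊓ ψ, fun v => by rw [Formula.realize_inf, hφ, hψ]⟩

theorem or (h : Dp P) (k : Dp Q) : Dp fun v => P v ∨ Q v :=
  (h.not.and k.not).not.congr fun v => by tauto

theorem imp (h : Dp P) (k : Dp Q) : Dp fun v => P v → Q v :=
  (h.not.or k).congr fun v => by tauto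

theorem rename (h : Dp P) (r : ℕ → ℕ) : Dp fun v => P fun i => v (r i) := by
  let _ := arithStructure ∅
  obtain ⟨φ, hφ⟩ := h
  exact ⟨φ.relabel r, fun v => by rw [Formula.realize_relabel, hφ]; rfl⟩

theorem ex {P : ℕ → (ℕ → ℕ) → Prop} (h : Dp fun v => P (v 0) fun i => v (i + 1)) :
    Dp fun v => ∃ m, P m v := by
  let _ := arithStructure ∅
  obtain ⟨φ, hφ⟩ := h
  refine ⟨(φ.relabel fun i : ℕ => i.casesOn (Sum.inr ()) Sum.inl :
    arithLang.Formula (ℕ ⊕ Unit)).iExs Unit, fun v => ?_⟩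
  rw [Formula.realize_iExs]
  simp only [Formula.realize_relabel, hφ]
  exact ⟨fun ⟨i, hi⟩ => ⟨i (), hi⟩, fun ⟨m, hm⟩ => ⟨fun _ => m, hm⟩⟩

theorem all {P : ℕ → (ℕ → ℕ) → Prop} (h : Dp fun v => P (v 0) fun i => v (i + 1)) :
    Dp fun v => ∀ m, P m v :=
  (ex (P := fun m v => ¬ P m v) h.not).not.congr fun v => by push Not; rfl

end Dp

theorem dp_eq (i j : ℕ) : Dp fun v => v i = v j := by
  let _ := arithStructure ∅
  exact ⟨(Term.var i).equal (Term.var j), fun v => by simp [Formula.realize_equal]⟩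

theorem dp_lt (i j : ℕ) : Dp fun v => v i < v j := by
  let _ := arithStructure ∅
  let R : arithLang.Relations 2 := ArRel.lt
  exact ⟨R.formula₂ (Term.var i) (Term.var j), fun v => Formula.realize_rel₂.trans Iff.rfl⟩

theorem dp_zero (i : ℕ) : Dp fun v => v i = 0 := by
  let _ := arithStructure ∅
  exact ⟨(Term.var i).equal (Constants.term (L := arithLang) ArFunc.zero), fun v => by
    rw [Formula.realize_equal]; rfl⟩

theorem dp_one (i : ℕ) : Dp fun v => v i = 1 := by
  let _ := arithStructure ∅
  exact ⟨(Term.var i).equal (Constants.term (L := arithLang) ArFunc.one), fun v => by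
    rw [Formula.realize_equal]; rfl⟩

theorem dp_add (i j k : ℕ) : Dp fun v => v i = v j + v k := by
  let _ := arithStructure ∅
  let F : arithLang.Functions 2 := ArFunc.add
  exact ⟨(Term.var i).equal (F.apply₂ (Term.var j) (Term.var k)), fun v => by
    rw [Formula.realize_equal, Term.realize_functions_apply₂]; rfl⟩

theorem dp_mul (i j k : ℕ) : Dp fun v => v i = v j * v k := by
  let _ := arithStructure ∅
  let F : arithLang.Functions 2 := ArFunc.mul
  exact ⟨(Term.var i).equal (F.apply₂ (Term.var j) (Term.var k)), fun v => by
    rw [Formula.realize_equal, Term.realize_functions_apply₂]; rfl⟩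

/-- A function of assignments with arithmetically definable graph. -/
def Df (f : (ℕ → ℕ) → ℕ) : Prop := Dp fun v => v 0 = f fun i => v (i + 1)

namespace Df

variable {f g : (ℕ → ℕ) → ℕ}

theorem sub {P : ℕ → (ℕ → ℕ) → Prop} (hf : Df f) (h : Dp fun v => P (v 0) fun i => v (i + 1)) :
    Dp fun v => P (f v) v :=
  (Dp.ex (P := fun m v => m = f v ∧ P m v) (Dp.and hf h)).congr fun v => by simp

theorem var (i : ℕ) : Df fun v => v i := dp_eq 0 (i + 1)

theorem zero : Df fun _ => 0 := dp_zero 0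

theorem one : Df fun _ => 1 := dp_one 0

theorem rename (hf : Df f) (r : ℕ → ℕ) : Df fun v => f fun i => v (r i) :=
  Dp.rename (P := fun v => v 0 = f fun i => v (i + 1)) hf
    fun i => Nat.casesOn (motive := fun _ => ℕ) i 0 fun j => r j + 1

theorem shift (hf : Df f) : Df fun v => f fun i => v (i + 1) := hf.rename fun i => i + 1

theorem add (hf : Df f) (hg : Df g) : Df fun v => f v + g v :=
  sub (P := fun m v => v 0 = m + g fun i => v (i + 1)) hf.shift <|
    sub (P := fun m v => v 1 = v 0 + m) hg.shift.shift <| dp_add 2 1 0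

theorem mul (hf : Df f) (hg : Df g) : Df fun v => f v * g v :=
  sub (P := fun m v => v 0 = m * g fun i => v (i + 1)) hf.shift <|
    sub (P := fun m v => v 1 = v 0 * m) hg.shift.shift <| dp_mul 2 1 0

theorem eq (hf : Df f) (hg : Df g) : Dp fun v => f v = g v :=
  sub (P := fun m v => m = g v) hf <| sub (P := fun m v => v 0 = m) hg.shift <| dp_eq 1 0

theorem lt (hf : Df f) (hg : Df g) : Dp fun v => f v < g v :=
  sub (P := fun m v => m < g v) hf <| sub (P := fun m v => v 0 < m) hg.shift <| dp_lt 1 0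

end Df

/-- A unary function on `ℕ` with arithmetically definable graph. -/
def Dg (f : ℕ → ℕ) : Prop := Dp fun v => v 0 = f (v 1)

theorem Dg.app {f : ℕ → ℕ} {g : (ℕ → ℕ) → ℕ} (hf : Dg f) (hg : Df g) : Df fun v => f (g v) :=
  Df.sub (P := fun m v => v 0 = f m) hg.shift <|
    Dp.rename (P := fun v => v 0 = f (v 1)) hf fun i =>
      Nat.casesOn (motive := fun _ => ℕ) i 1 fun _ => 0

theorem Df.dg {f : ℕ → ℕ} (h : Df fun v => f (v 0)) : Dg f := h

theorem Df.pair {f g : (ℕ → ℕ) → ℕ} (hf : Df f) (hg : Df g) : Df fun v => Nat.pair (f v) (g v) := by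
  have h : Dp fun v => (v 1 < v 2 ∧ v 0 = v 2 * v 2 + v 1) ∨
      (¬ v 1 < v 2 ∧ v 0 = v 1 * v 1 + v 1 + v 2) :=
    ((dp_lt 1 2).and ((var 0).eq (((var 2).mul (var 2)).add (var 1)))).or
      ((dp_lt 1 2).not.and ((var 0).eq ((((var 1).mul (var 1)).add (var 1)).add (var 2))))
  have h' : Dp fun v => v 0 = Nat.pair (v 1) (v 2) := h.congr fun v => by
    unfold Nat.pair
    split_ifs with c <;> simp [c]
  exact sub (P := fun m v => v 0 = Nat.pair m (g fun i => v (i + 1))) hf.shift <|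
    sub (P := fun m v => v 1 = Nat.pair (v 0) m) hg.shift.shift <|
      h'.rename (fun i => [2, 1, 0].getD i 0)

theorem dg_fst : Dg fun n => n.unpair.1 :=
  (Dp.ex (P := fun m v => Nat.pair (v 0) m = v 1)
    (((Df.var 1).pair (Df.var 0)).eq (Df.var 2))).congr fun v => by
    constructor
    · intro h; exact ⟨(v 1).unpair.2, by rw [h, Nat.pair_unpair]⟩
    · rintro ⟨m, h⟩; simp [← h]

theorem dg_snd : Dg fun n => n.unpair.2 :=
  (Dp.ex (P := fun m v => Nat.pair m (v 0) = v 1)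
    (((Df.var 0).pair (Df.var 1)).eq (Df.var 2))).congr fun v => by
    constructor
    · intro h; exact ⟨(v 1).unpair.1, by rw [h, Nat.pair_unpair]⟩
    · rintro ⟨m, h⟩; simp [← h]

theorem Df.mod_succ {f g : (ℕ → ℕ) → ℕ} (hf : Df f) (hg : Df g) :
    Df fun v => f v % (g v + 1) := by
  have h : Dp fun v => v 0 < v 2 + 1 ∧ ∃ q, v 1 = (v 2 + 1) * q + v 0 :=
    ((var 0).lt ((var 2).add one)).and <| Dp.ex (P := fun q v => v 1 = (v 2 + 1) * q + v 0) <|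
      (var 2).eq ((((var 3).add one).mul (var 0)).add (var 1))
  have h' : Dp fun v => v 0 = v 1 % (v 2 + 1) := h.congr fun v => by
    constructor
    · intro h
      exact ⟨h ▸ Nat.mod_lt _ (Nat.succ_pos _), v 1 / (v 2 + 1), by rw [h, Nat.div_add_mod]⟩
    · rintro ⟨h, q, e⟩
      rw [e, Nat.mul_add_mod, Nat.mod_eq_of_lt h]
  exact sub (P := fun m v => v 0 = m % ((g fun i => v (i + 1)) + 1)) hf.shift <|
    sub (P := fun m v => v 1 = v 0 % (m + 1)) hg.shift.shift <|
      h'.rename (fun i => [2, 1, 0].getD i 0)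

theorem Df.beta {f g : (ℕ → ℕ) → ℕ} (hf : Df f) (hg : Df g) :
    Df fun v => Nat.beta (f v) (g v) :=
  (dg_fst.app hf).mod_succ ((hg.add one).mul (dg_snd.app hf))

theorem exists_beta (f : ℕ → ℕ) (n : ℕ) : ∃ s, ∀ i < n, Nat.beta s i = f i := by
  refine ⟨Nat.unbeta ((List.range n).map f), fun i hi => ?_⟩
  have := Nat.beta_unbeta_coe ((List.range n).map f) ⟨i, by simpa using hi⟩
  simpa using this

theorem dg_of_primrec {f : ℕ → ℕ} (hf : Nat.Primrec f) : Dg f := by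
  induction hf with
  | zero => exact Df.zero
  | succ => exact (Df.var 0).add Df.one
  | left => exact dg_fst
  | right => exact dg_snd
  | pair _ _ hf hg => exact Df.dg ((hf.app (Df.var 0)).pair (hg.app (Df.var 0)))
  | comp _ _ hf hg => exact Df.dg (hf.app (hg.app (Df.var 0)))
  | @prec f g _ _ hf hg =>
    have h : Dp fun v => ∃ s, Nat.beta s 0 = f (v 1).unpair.1 ∧
        (∀ i, i < (v 1).unpair.2 →
          Nat.beta s (i + 1) = g (Nat.pair (v 1).unpair.1 (Nat.pair i (Nat.beta s i)))) ∧
        v 0 = Nat.beta s (v 1).unpair.2 := by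
      refine Dp.ex (((Df.var 0).beta Df.zero).eq (hf.app (dg_fst.app (Df.var 2))) |>.and <|
        Dp.and ?_ ((Df.var 1).eq ((Df.var 0).beta (dg_snd.app (Df.var 2)))))
      exact Dp.all (P := fun i v => i < (v 2).unpair.2 → Nat.beta (v 0) (i + 1) =
        g (Nat.pair (v 2).unpair.1 (Nat.pair i (Nat.beta (v 0) i)))) <|
        ((Df.var 0).lt (dg_snd.app (Df.var 3))).imp <|
        ((Df.var 1).beta ((Df.var 0).add Df.one)).eq <| hg.app <|
          (dg_fst.app (Df.var 3)).pair <| (Df.var 0).pair <| (Df.var 1).beta (Df.var 0)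
    refine h.congr fun v => ?_
    let F : ℕ → ℕ := fun n => n.rec (f (v 1).unpair.1)
      fun y IH => g (Nat.pair (v 1).unpair.1 (Nat.pair y IH))
    change v 0 = F (v 1).unpair.2 ↔ _
    constructor
    · intro e
      obtain ⟨s, hs⟩ := exists_beta F ((v 1).unpair.2 + 1)
      refine ⟨s, hs 0 (Nat.succ_pos _), fun i hi => ?_, by rw [e, hs _ (Nat.lt_succ_self _)]⟩
      rw [hs _ (by omega), hs _ (by omega)]
    · rintro ⟨s, h0, h1, e⟩
      have : ∀ i ≤ (v 1).unpair.2, Nat.beta s i = F i := by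
        intro i
        induction i with
        | zero => exact fun _ => h0
        | succ i ih => intro hi; rw [h1 i (by omega), ih (by omega)]
      rw [e, this _ le_rfl]

theorem isArithmetical_iff {X : Set ℕ} : IsArithmetical X ↔ Dp fun v => v 0 ∈ X := by
  let _ := arithStructure ∅
  constructor
  · rintro ⟨φ, rfl⟩
    exact ⟨φ.relabel fun _ => 0, fun v => by rw [Formula.realize_relabel]; rfl⟩
  · rintro ⟨φ, hφ⟩
    refine ⟨φ.relabel fun _ => 0, Set.ext fun n => ?_⟩
    rw [Set.mem_ofPred_eq, Formula.realize_relabel, hφ]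
    rfl

/-! ## Arithmetical predicates on `Primcodable` types -/

/-- A predicate on a `Primcodable` type whose set of codes is arithmetical. -/
def Ar {α : Type} [Primcodable α] (p : α → Prop) : Prop :=
  IsArithmetical { n | ∃ a, Encodable.encode a = n ∧ p a }

/-- A function between `Primcodable` types with arithmetical graph. -/
def ArF {α β : Type} [Primcodable α] [Primcodable β] (f : α → β) : Prop :=
  Ar fun x : α × β => f x.1 = x.2

section CourseOfValues

variable {β : Type}

/-- Course-of-values recursion: the list of the first `n` values, most recent value first. -/
def covList (G : List β → β) : ℕ → List β
  | 0 => []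
  | n + 1 => G (covList G n) :: covList G n

@[simp] theorem length_covList (G : List β → β) (n : ℕ) : (covList G n).length = n := by
  induction n with
  | zero => rfl
  | succ n ih => simp [covList, ih]

theorem covList_eq_map (G : List β → β) (n : ℕ) :
    (covList G n).reverse = (List.range n).map fun m => G (covList G m) := by
  induction n with
  | zero => rfl
  | succ n ih => simp [covList, ih, List.range_succ]

theorem covList_getElem? (G : List β → β) {m n : ℕ} (h : m < n) :
    (covList G n).reverse[m]? = some (G (covList G m)) := by
  simp [covList_eq_map, h]

theorem eq_covList_iff (G : List β → β) (n : ℕ) (l : List β) :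
    covList G n = l ↔ l.length = n ∧ ∀ l₁ z l₂, l = l₁ ++ z :: l₂ → z = G l₂ := by
  constructor
  · rintro rfl
    refine ⟨length_covList G n, ?_⟩
    induction n with
    | zero => intro l₁ z l₂ h; simp [covList] at h
    | succ n ih =>
      intro l₁ z l₂ h
      cases l₁ with
      | nil =>
        simp only [covList, List.nil_append, List.cons.injEq] at h
        rw [← h.1, h.2]
      | cons w l₁ =>
        simp only [covList, List.cons_append, List.cons.injEq] at h
        exact ih _ _ _ h.2
  · rintro ⟨hl, h⟩
    induction l generalizing n with
    | nil => simp only [List.length_nil] at hl; rw [← hl]; rfl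
    | cons w l ih =>
      rw [List.length_cons] at hl
      subst hl
      have : covList G l.length = l := ih _ rfl fun l₁ z l₂ e => h (w :: l₁) z l₂ (by rw [e]; rfl)
      rw [covList, this, h [] w l rfl]

end CourseOfValues

section Ar

variable {α β γ δ : Type} [Primcodable α] [Primcodable β] [Primcodable γ] [Primcodable δ]

theorem dp_mem_range_encode :
    Dp fun v => Encodable.encode (Encodable.decode (α := α) (v 0)) = v 0 + 1 :=
  ((dg_of_primrec (Primcodable.prim α)).app (Df.var 0)).eq ((Df.var 0).add Df.one)

theorem encode_decode_eq_succ_iff {n : ℕ} :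
    Encodable.encode (Encodable.decode (α := α) n) = n + 1 ↔ ∃ a : α, Encodable.encode a = n := by
  constructor
  · intro h
    cases e : Encodable.decode (α := α) n with
    | none => simp [e] at h
    | some a => exact ⟨a, by simpa [e] using h⟩
  · rintro ⟨a, rfl⟩
    simp

namespace Ar

theorem congr {p q : α → Prop} (h : Ar p) (e : ∀ a, q a ↔ p a) : Ar q := by
  have : q = p := funext fun a => propext (e a)
  exact this ▸ h

theorem not {p : α → Prop} (h : Ar p) : Ar fun a => ¬ p a := by
  unfold Ar at *
  rw [isArithmetical_iff] at *
  refine ((dp_mem_range_encode (α := α)).and h.not).congr fun v => ?_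
  rw [encode_decode_eq_succ_iff]
  constructor
  · rintro ⟨a, e, ha⟩
    refine ⟨⟨a, e⟩, ?_⟩
    rintro ⟨b, e', hb⟩
    exact ha (Encodable.encode_injective (e.trans e'.symm) ▸ hb)
  · rintro ⟨⟨a, e⟩, h⟩
    exact ⟨a, e, fun ha => h ⟨a, e, ha⟩⟩

theorem and {p q : α → Prop} (h : Ar p) (k : Ar q) : Ar fun a => p a ∧ q a := by
  unfold Ar at *
  rw [isArithmetical_iff] at *
  refine (h.and k).congr fun v => ?_
  constructor
  · rintro ⟨a, e, ha, hb⟩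
    exact ⟨⟨a, e, ha⟩, ⟨a, e, hb⟩⟩
  · rintro ⟨⟨a, e, ha⟩, ⟨b, e', hb⟩⟩
    exact ⟨a, e, ha, Encodable.encode_injective (e.trans e'.symm) ▸ hb⟩

theorem or {p q : α → Prop} (h : Ar p) (k : Ar q) : Ar fun a => p a ∨ q a :=
  (h.not.and k.not).not.congr fun a => by tauto

theorem imp {p q : α → Prop} (h : Ar p) (k : Ar q) : Ar fun a => p a → q a :=
  (h.not.or k).congr fun a => by tauto

theorem ex {p : α → β → Prop} (h : Ar fun x : α × β => p x.1 x.2) : Ar fun a => ∃ b, p a b := by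
  unfold Ar at *
  rw [isArithmetical_iff] at *
  refine (Dp.ex (P := fun m v => Nat.pair (v 0) m ∈ _) (Df.sub
    (P := fun m _ => m ∈ _) ((Df.var 1).pair (Df.var 0)) h)).congr fun v => ?_
  constructor
  · rintro ⟨a, e, b, hb⟩
    exact ⟨Encodable.encode b, (a, b), by rw [Encodable.encode_prod_val, e], hb⟩
  · rintro ⟨m, ⟨a, b⟩, e, hb⟩
    rw [Encodable.encode_prod_val, Nat.pair_eq_pair] at e
    exact ⟨a, e.1, b, hb⟩

theorem all {p : α → β → Prop} (h : Ar fun x : α × β => p x.1 x.2) : Ar fun a => ∀ b, p a b :=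
  (ex (p := fun a b => ¬ p a b) h.not).not.congr fun v => by push Not; rfl

theorem comp {p : β → Prop} {f : α → β} (h : Ar p) (hf : Primrec f) : Ar fun a => p (f a) := by
  unfold Ar at *
  rw [isArithmetical_iff] at *
  refine ((dp_mem_range_encode (α := α)).and <| Dp.ex
    (P := fun m v => m + 1 = Encodable.encode ((Encodable.decode (α := α) (v 0)).map f) ∧ m ∈ _)
    ((((Df.var 0).add Df.one).eq ((dg_of_primrec hf).app (Df.var 1))).and h)).congr fun v => ?_
  rw [encode_decode_eq_succ_iff]
  constructor
  · rintro ⟨a, e, ha⟩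
    exact ⟨⟨a, e⟩, Encodable.encode (f a), by simp [← e], f a, rfl, ha⟩
  · rintro ⟨⟨a, e⟩, m, hm, b, rfl, hb⟩
    have : b = f a := by simpa [← e] using hm
    subst this
    exact ⟨a, e, hb⟩

theorem of_primrec {p : α → Prop} (h : PrimrecPred p) : Ar p := by
  obtain ⟨_, h⟩ := h
  have : Ar fun b : Bool => b = true := by
    unfold Ar
    rw [isArithmetical_iff]
    exact (dp_one 0).congr fun v => by simp [eq_comm]
  exact (this.comp h).congr fun a => by simp

theorem eq {f g : α → β} (hf : Primrec f) (hg : Primrec g) : Ar fun a => f a = g a :=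
  (of_primrec ((Primrec.eq (α := ℕ)).comp (Primrec.encode.comp hf) (Primrec.encode.comp hg))).congr
    fun _ => Encodable.encode_injective.eq_iff.symm

theorem _root_.ArMorley.ar_nat {X : Set ℕ} : (Ar fun n => n ∈ X) ↔ IsArithmetical X := by
  simp [Ar]

theorem sub {p : α → β → Prop} {f : α → β} (h : Ar fun x : α × β => p x.1 x.2) (hf : ArF f) :
    Ar fun a => p a (f a) :=
  (ex (p := fun a b => f a = b ∧ p a b) (and hf h)).congr fun a => by simp

end Ar

namespace ArF

theorem congr {f g : α → β} (h : ArF f) (e : ∀ a, g a = f a) : ArF g := by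
  have : g = f := funext e
  exact this ▸ h

theorem of_primrec {f : α → β} (h : Primrec f) : ArF f :=
  Ar.eq (h.comp Primrec.fst) Primrec.snd

theorem comp {f : β → γ} {g : α → β} (hf : ArF f) (hg : ArF g) : ArF fun a => f (g a) :=
  Ar.sub (p := fun (x : α × γ) b => f b = x.2) (f := fun x : α × γ => g x.1)
    (Ar.comp hf (f := fun x : (α × γ) × β => (x.2, x.1.2))
      (Primrec.snd.pair (Primrec.snd.comp Primrec.fst)))
    (Ar.comp hg (f := fun x : (α × γ) × β => (x.1.1, x.2))
      ((Primrec.fst.comp Primrec.fst).pair Primrec.snd))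

theorem _root_.ArMorley.Ar.compF {p : β → Prop} {f : α → β} (h : Ar p) (hf : ArF f) :
    Ar fun a => p (f a) :=
  Ar.sub (p := fun _ b => p b) (h.comp Primrec.snd) hf

theorem eq {f g : α → β} (hf : ArF f) (hg : ArF g) : Ar fun a => f a = g a :=
  Ar.sub (p := fun a b => f a = b) hf hg

theorem pair {f : α → β} {g : α → γ} (hf : ArF f) (hg : ArF g) : ArF fun a => (f a, g a) :=
  (Ar.and (eq (hf.comp (of_primrec Primrec.fst)) (of_primrec (Primrec.fst.comp Primrec.snd)))
    (eq (hg.comp (of_primrec Primrec.fst)) (of_primrec (Primrec.snd.comp Primrec.snd)))).congr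
    fun _ => Prod.ext_iff

theorem ite {c : α → Prop} [DecidablePred c] {f g : α → β} (hc : Ar c) (hf : ArF f) (hg : ArF g) :
    ArF fun a => if c a then f a else g a :=
  (((hc.comp Primrec.fst).and hf).or ((hc.comp Primrec.fst).not.and hg)).congr
    fun x : α × β => by by_cases h : c x.1 <;> simp [h]

theorem decide {c : α → Prop} [DecidablePred c] (hc : Ar c) : ArF fun a => decide (c a) :=
  (ite hc (of_primrec (Primrec.const true)) (of_primrec (Primrec.const false))).congr
    fun a => by by_cases h : c a <;> simp [h]

theorem list_map {f : α → β → γ} {g : α → List β} (hf : ArF fun x : α × β => f x.1 x.2)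
    (hg : ArF g) : ArF fun a => (g a).map (f a) := by
  have h : ArF fun x : α × List β => x.2.map (f x.1) := by
    refine Ar.congr (p := fun x : (α × List β) × List γ => x.2.length = x.1.2.length ∧
      ∀ (i : ℕ) (b : β), x.1.2[i]? = some b → x.2[i]? = some (f x.1.1 b))
      (Ar.and (Ar.eq (Primrec.list_length.comp Primrec.snd)
        (Primrec.list_length.comp (Primrec.snd.comp Primrec.fst)))
        (Ar.all <| Ar.all <| Ar.imp ?_ ?_)) ?_
    · exact Ar.eq (Primrec.list_getElem?.comp
        (Primrec.snd.comp (Primrec.fst.comp (Primrec.fst.comp Primrec.fst)))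
        (Primrec.snd.comp Primrec.fst)) (Primrec.option_some.comp Primrec.snd)
    · refine eq (of_primrec <| Primrec.list_getElem?.comp
        (Primrec.snd.comp (Primrec.fst.comp Primrec.fst)) (Primrec.snd.comp Primrec.fst)) ?_
      exact (of_primrec Primrec.option_some).comp <| hf.comp (of_primrec
        ((Primrec.fst.comp (Primrec.fst.comp (Primrec.fst.comp Primrec.fst))).pair Primrec.snd))
    · rintro ⟨⟨a, l⟩, l'⟩
      simp only
      constructor
      · rintro rfl
        simp +contextual
      · rintro ⟨h1, h2⟩
        refine List.ext_getElem? fun i => ?_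
        rw [List.getElem?_map]
        cases e : l[i]? with
        | none =>
          rw [List.getElem?_eq_none_iff] at e
          exact (List.getElem?_eq_none_iff.2 (h1 ▸ e)).symm
        | some b => rw [h2 i b e]; rfl
  exact h.comp ((of_primrec Primrec.id).pair hg)

end ArF

/-- Arithmetical uniformization. -/
theorem Ar.exists_choice [Inhabited β] {p : α → β → Prop} (h : Ar fun x : α × β => p x.1 x.2) :
    ∃ f : α → β, ArF f ∧ ∀ a, (∃ b, p a b) → p a (f a) := by
  have key : ∀ a, ∃ b, (p a b ∧ ∀ b', p a b' → Encodable.encode b ≤ Encodable.encode b') ∨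
      ((¬ ∃ b, p a b) ∧ b = default) := by
    intro a
    by_cases ha : ∃ b, p a b
    · obtain ⟨b, hb, hmin⟩ := (Set.IsWF.of_wellFoundedLT (Encodable.encode '' {b | p a b})).min_mem
        (Set.Nonempty.image _ ha)
      refine ⟨b, Or.inl ⟨hb, fun b' hb' => ?_⟩⟩
      rw [hmin]
      exact Set.IsWF.min_le _ _ (Set.mem_image_of_mem _ hb')
    · exact ⟨default, Or.inr ⟨ha, rfl⟩⟩
  choose f hf using key
  refine ⟨f, ?_, fun a ha => ((hf a).resolve_right fun h => h.1 ha).1⟩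
  refine Ar.congr (p := fun x : α × β =>
    (p x.1 x.2 ∧ ∀ b', p x.1 b' → Encodable.encode x.2 ≤ Encodable.encode b') ∨
      ((¬ ∃ b, p x.1 b) ∧ x.2 = default)) ?_ ?_
  · have h' : Ar fun x : (α × β) × β => p x.1.1 x.2 :=
      h.comp (f := fun x : (α × β) × β => (x.1.1, x.2))
        ((Primrec.fst.comp Primrec.fst).pair Primrec.snd)
    refine (h.and (Ar.all (h'.imp (Ar.of_primrec (Primrec.nat_le.comp ?_ ?_))))).or
      ((Ar.ex h').not.and (Ar.eq Primrec.snd (Primrec.const _)))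
    · exact Primrec.encode.comp (Primrec.snd.comp Primrec.fst)
    · exact Primrec.encode.comp Primrec.snd
  · rintro ⟨a, b⟩
    constructor
    · intro e
      change f a = b at e
      exact e ▸ hf a
    · intro h
      change f a = b
      rcases hf a with h1 | h1 <;> rcases h with h2 | h2
      · exact Encodable.encode_injective (le_antisymm (h1.2 _ h2.1) (h2.2 _ h1.1))
      · exact absurd ⟨_, h1.1⟩ h2.1
      · exact absurd ⟨_, h2.1⟩ h1.1
      · exact h1.2.trans h2.2.symm

theorem ArF.covList {G : α → List β → β} (h : ArF fun x : α × List β => G x.1 x.2) :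
    ArF fun x : α × ℕ => covList (G x.1) x.2 := by
  refine Ar.congr (p := fun x : (α × ℕ) × List β => x.2.length = x.1.2 ∧
    ∀ l₁ z l₂, x.2 = l₁ ++ z :: l₂ → z = G x.1.1 l₂) (Ar.and (Ar.eq ?_ ?_) (Ar.all <| Ar.all <|
      Ar.all <| Ar.imp ?_ ?_)) fun x => eq_covList_iff _ _ _
  · exact Primrec.list_length.comp Primrec.snd
  · exact Primrec.snd.comp Primrec.fst
  · exact Ar.eq (Primrec.snd.comp (Primrec.fst.comp (Primrec.fst.comp Primrec.fst)))
      (Primrec.list_append.comp (Primrec.snd.comp (Primrec.fst.comp Primrec.fst))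
        (Primrec.list_cons.comp (Primrec.snd.comp Primrec.fst) Primrec.snd))
  · exact ArF.eq (ArF.of_primrec (Primrec.snd.comp Primrec.fst)) <| h.comp <| ArF.of_primrec <|
      (Primrec.fst.comp (Primrec.fst.comp (Primrec.fst.comp (Primrec.fst.comp
        Primrec.fst)))).pair Primrec.snd

theorem ArF.cov {G : α → List β → β} (h : ArF fun x : α × List β => G x.1 x.2) :
    ArF fun x : α × ℕ => G x.1 (ArMorley.covList (G x.1) x.2) :=
  h.comp ((of_primrec Primrec.fst).pair h.covList)

theorem ArF.count {C : ℕ → Prop} [DecidablePred C] (hC : Ar C) : ArF (Nat.count C) := by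
  let G : Unit → List ℕ → ℕ := fun _ l => l.headI + if C l.length then 1 else 0
  have hG : ArF fun x : Unit × List ℕ => G x.1 x.2 := by
    have : ArF fun x : ℕ × ℕ => x.1 + x.2 := of_primrec Primrec.nat_add
    exact this.comp ((of_primrec (Primrec.list_headI.comp Primrec.snd)).pair
      (ite (hC.comp (Primrec.list_length.comp Primrec.snd)) (of_primrec (Primrec.const 1))
        (of_primrec (Primrec.const 0))))
  have key : ∀ n, (ArMorley.covList (G ()) n).headI = Nat.count C n := by
    intro n
    induction n with
    | zero => rfl
    | succ n ih => simp [ArMorley.covList, G, Nat.count_succ, ih]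
  exact ((of_primrec Primrec.list_headI).comp
    (hG.covList.comp (of_primrec ((Primrec.const ()).pair Primrec.id)))).congr
      fun n => (key n).symm

end Ar

/-! ## Arithmetical ultrafilters -/

/-- `i` follows the pattern `l` on the first sets of the family `R`. -/
def Follows (R : ℕ → ℕ → Prop) (l : List Bool) (i : ℕ) : Prop :=
  ∀ m, (l.reverse[m]? = some true → R i m) ∧ (l.reverse[m]? = some false → ¬ R i m)

theorem follows_cons {R : ℕ → ℕ → Prop} {l : List Bool} {b : Bool} {i : ℕ} :
    Follows R (b :: l) i ↔ Follows R l i ∧ (R i l.length ↔ b = true) := by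
  unfold Follows
  constructor
  · intro h
    refine ⟨fun m => ?_, ?_⟩
    · have hm := h m
      simp only [List.reverse_cons] at hm
      constructor <;> intro e
      · exact hm.1 (List.getElem?_append_left (l₂ := [b]) (List.getElem?_eq_some_iff.1 e).1 ▸ e)
      · exact hm.2 (List.getElem?_append_left (l₂ := [b]) (List.getElem?_eq_some_iff.1 e).1 ▸ e)
    · have := h l.length
      simp only [List.reverse_cons, List.getElem?_append, List.length_reverse, lt_irrefl] at this
      cases b <;> simp_all
  · rintro ⟨h, hb⟩ m
    simp only [List.reverse_cons, List.getElem?_append, List.length_reverse]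
    split_ifs with hm
    · exact h m
    · rcases Nat.eq_or_lt_of_le (not_lt.1 hm) with e | e
      · subst e
        cases b <;> simp_all
      · rw [List.getElem?_eq_none (by simp; omega)]
        simp

/-- A uniformly arithmetical sequence of subsets of `ℕ` is decided arithmetically by some
nonprincipal ultrafilter. -/
theorem Ar.exists_ultrafilter {R : ℕ → ℕ → Prop} (hR : Ar fun x : ℕ × ℕ => R x.1 x.2) :
    ∃ U : Ultrafilter ℕ, (U : Filter ℕ) ≤ Filter.atTop ∧ Ar fun n => ∀ᶠ i in U, R i n := by
  classical
  let G : Unit → List Bool → Bool := fun _ l =>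
    decide (∀ b, ∃ i, b ≤ i ∧ R i l.length ∧ Follows R l i)
  have hG : ArF fun x : Unit × List Bool => G x.1 x.2 := by
    refine ArF.decide (Ar.all <| Ar.ex <| Ar.and ?_ <| Ar.and ?_ <| Ar.all <| Ar.and ?_ ?_)
    · exact Ar.of_primrec (Primrec.nat_le.comp (Primrec.snd.comp Primrec.fst) Primrec.snd)
    · exact hR.comp (Primrec.snd.pair (Primrec.list_length.comp
        (Primrec.snd.comp (Primrec.fst.comp Primrec.fst))))
    · refine (Ar.eq (Primrec.list_getElem?.comp (Primrec.list_reverse.comp (Primrec.snd.comp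
        (Primrec.fst.comp (Primrec.fst.comp Primrec.fst)))) Primrec.snd) (Primrec.const _)).imp ?_
      exact hR.comp ((Primrec.snd.comp Primrec.fst).pair Primrec.snd)
    · refine (Ar.eq (Primrec.list_getElem?.comp (Primrec.list_reverse.comp (Primrec.snd.comp
        (Primrec.fst.comp (Primrec.fst.comp Primrec.fst)))) Primrec.snd) (Primrec.const _)).imp ?_
      exact (hR.comp ((Primrec.snd.comp Primrec.fst).pair Primrec.snd)).not
  let l := covList (G ())
  have hinf : ∀ n b, ∃ i, b ≤ i ∧ Follows R (l n) i := by
    intro n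
    induction n with
    | zero => exact fun b => ⟨b, le_rfl, fun m => by simp [l, covList]⟩
    | succ n ih =>
      intro b
      simp only [l, covList, follows_cons, length_covList]
      by_cases h : ∀ b, ∃ i, b ≤ i ∧ R i n ∧ Follows R (l n) i
      · have hg : G () (l n) = true := by simpa [G, l] using h
        obtain ⟨i, h1, h2, h3⟩ := h b
        exact ⟨i, h1, h3, by simp [h2, show G () (covList (G ()) n) = true from hg]⟩
      · have hg : G () (l n) = false := by simpa [G, l] using h
        push Not at h
        obtain ⟨b', hb'⟩ := h
        obtain ⟨i, h1, h3⟩ := ih (max b b')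
        exact ⟨i, le_of_max_le_left h1, h3, by
          simp only [show G () (covList (G ()) n) = false from hg, Bool.false_eq_true, iff_false]
          exact fun h2 => hb' i (le_of_max_le_right h1) h2 h3⟩
  let W : ℕ → Set ℕ := fun n => {i | n ≤ i ∧ Follows R (l n) i}
  have hanti : Antitone W := antitone_nat_of_succ_le fun n i hi =>
    ⟨(Nat.le_succ n).trans hi.1, (follows_cons.1 hi.2).1⟩
  have hne : (⨅ n, Filter.principal (W n)).NeBot := by
    refine Filter.iInf_neBot_of_directed (Antitone.directed_ge fun m n hmn => ?_)
      fun n => Filter.principal_neBot_iff.2 (hinf n n)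
    exact Filter.principal_mono.2 (hanti hmn)
  have hW : ∀ n, ∀ᶠ i in (Ultrafilter.of (⨅ n, Filter.principal (W n)) : Filter ℕ), i ∈ W n :=
    fun n => Ultrafilter.of_le _ (Filter.mem_iInf_of_mem n (Filter.mem_principal_self _))
  refine ⟨Ultrafilter.of (⨅ n, Filter.principal (W n)), ?_, ?_⟩
  · exact fun s hs => by
      obtain ⟨n, hn⟩ := Filter.mem_atTop_sets.1 hs
      exact Filter.mem_of_superset (hW n) fun i hi => hn i hi.1
  · have : Ar fun n : ℕ => G () (l n) = true :=
      ArF.eq (hG.cov.comp (ArF.of_primrec ((Primrec.const ()).pair Primrec.id)))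
        (ArF.of_primrec (Primrec.const _))
    refine this.congr fun n => ?_
    have hn : ∀ᶠ i in (Ultrafilter.of (⨅ n, Filter.principal (W n)) : Filter ℕ),
        (R i n ↔ G () (l n) = true) := (hW (n + 1)).mono fun i hi => by
      have := (follows_cons.1 hi.2).2
      rwa [length_covList] at this
    rw [Filter.eventually_congr hn, Filter.eventually_const]

/-! ## Codes of formulas -/

section Codes

variable {α β : Type}

theorem listCode_injective : Function.Injective listCode := Encodable.encode_injective

theorem sigmaCode_injective {F : ℕ → Type*} {e : ∀ n, F n → ℕ}
    (he : ∀ n, Function.Injective (e n)) :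
    Function.Injective fun p : Σ n, F n => Nat.pair p.1 (e p.1 p.2) := by
  rintro ⟨n, f⟩ ⟨m, f'⟩ h
  obtain ⟨h1, h2⟩ := Nat.pair_eq_pair.1 h
  dsimp only at h1
  subst h1
  exact congrArg _ (he _ h2)

theorem termCode_injective (g : GoedelCoding L) {enc : α → ℕ} (h : Function.Injective enc) :
    Function.Injective (termCode g enc) := by
  intro t t' e
  refine Term.listEncode_injective (List.map_injective_iff.2 ?_ (listCode_injective e))
  rintro (a | p) (b | q) e <;> simp only [Sum.elim_inl, Sum.elim_inr] at e
  · exact congrArg _ (h (Nat.pair_eq_pair.1 e).2)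
  · exact absurd (Nat.pair_eq_pair.1 e).1 (by decide)
  · exact absurd (Nat.pair_eq_pair.1 e).1 (by decide)
  · exact congrArg _ (sigmaCode_injective g.encFun_inj (Nat.pair_eq_pair.1 e).2)

theorem formulaCode_injective (g : GoedelCoding L) {enc : α → ℕ} (h : Function.Injective enc)
    (n : ℕ) : Function.Injective (formulaCode (n := n) g enc) := by
  intro φ φ' e
  have hv : ∀ k, Function.Injective
      (Sum.elim (fun a => Nat.pair 0 (enc a)) (fun i : Fin k => Nat.pair 1 i.1)) := by
    rintro k (a | p) (b | q) e <;> simp only [Sum.elim_inl, Sum.elim_inr] at e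
    · exact congrArg _ (h (Nat.pair_eq_pair.1 e).2)
    · exact absurd (Nat.pair_eq_pair.1 e).1 (by decide)
    · exact absurd (Nat.pair_eq_pair.1 e).1 (by decide)
    · exact congrArg _ (Fin.ext (Nat.pair_eq_pair.1 e).2)
  have : (⟨n, φ⟩ : Σ n, L.BoundedFormula α n) = ⟨n, φ'⟩ := by
    refine BoundedFormula.listEncode_sigma_injective
      (List.map_injective_iff.2 ?_ (listCode_injective e))
    rintro (a | p | m) (b | q | m') e <;> simp only [Sum.elim_inl, Sum.elim_inr] at e
    · exact congrArg _ (sigmaCode_injective (fun k => termCode_injective g (hv k))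
        (Nat.pair_eq_pair.1 e).2)
    · exact absurd (Nat.pair_eq_pair.1 e).1 (by decide)
    · exact absurd (Nat.pair_eq_pair.1 e).1 (by decide)
    · exact absurd (Nat.pair_eq_pair.1 e).1 (by decide)
    · exact congrArg (Sum.inr ∘ Sum.inl)
        (sigmaCode_injective g.encRel_inj (Nat.pair_eq_pair.1 e).2)
    · exact absurd (Nat.pair_eq_pair.1 e).1 (by decide)
    · exact absurd (Nat.pair_eq_pair.1 e).1 (by decide)
    · exact absurd (Nat.pair_eq_pair.1 e).1 (by decide)
    · exact congrArg (Sum.inr ∘ Sum.inr) (Nat.pair_eq_pair.1 e).2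
  simpa using this

/-- Renaming of the free variables of a bounded formula. -/
def rename (r : α → β) {n : ℕ} (φ : L.BoundedFormula α n) : L.BoundedFormula β n :=
  φ.mapTermRel (g := id) (fun _ t => t.relabel (Sum.map r id)) (fun _ => id) (fun _ => id)

theorem realize_rename {M : Type} [L.Structure M] (r : α → β) (φ : L.Formula α) (v : β → M) :
    Formula.Realize (rename r φ : L.Formula β) v ↔ φ.Realize (v ∘ r) := by
  refine BoundedFormula.realize_mapTermRel_id (fun n t xs => ?_) (fun _ _ _ => rfl)
  rw [Term.realize_relabel, Sum.elim_comp_map]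
  rfl

theorem listEncode_relabel (r : α → β) (t : L.Term α) :
    (t.relabel r).listEncode = t.listEncode.map (Sum.map r id) := by
  induction t with
  | var => rfl
  | func f ts ih =>
    simp only [Term.relabel, Term.listEncode, List.map_cons, List.map_flatMap, Sum.map_inr, id]
    exact congrArg _ (congrArg (fun h => List.flatMap h _) (funext ih))

theorem listEncode_rename (r : α → β) {n : ℕ} (φ : L.BoundedFormula α n) :
    (rename r φ).listEncode =
      φ.listEncode.map (Sum.map (fun p => ⟨p.1, p.2.relabel (Sum.map r id)⟩) id) := by
  induction φ with
  | falsum => rfl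
  | equal => rfl
  | rel R ts =>
    simp only [rename, BoundedFormula.mapTermRel, BoundedFormula.listEncode, List.map_append,
      List.map_map]
    rfl
  | imp φ ψ h₁ h₂ =>
    simp only [rename] at h₁ h₂
    simp only [rename, BoundedFormula.mapTermRel, BoundedFormula.listEncode, List.map_append,
      h₁, h₂, List.map_cons]
    rfl
  | all φ h =>
    simp only [rename] at h
    simp only [rename, BoundedFormula.mapTermRel, BoundedFormula.listEncode, List.map_cons]
    exact congrArg _ h

theorem termCode_relabel (g : GoedelCoding L) (enc : β → ℕ) (r : α → β) (t : L.Term α) :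
    termCode g enc (t.relabel r) = termCode g (enc ∘ r) t := by
  unfold termCode
  rw [listEncode_relabel, List.map_map, Sum.elim_comp_map]
  rfl

theorem formulaCode_rename (g : GoedelCoding L) (enc : β → ℕ) (r : α → β) {n : ℕ}
    (φ : L.BoundedFormula α n) : formulaCode g enc (rename r φ) = formulaCode g (enc ∘ r) φ := by
  unfold formulaCode
  rw [listEncode_rename, List.map_map, Sum.elim_comp_map]
  congr 3
  funext p
  simp only [Function.comp_apply, termCode_relabel, Sum.elim_comp_map]
  rfl

/-- Apply `f` to every entry of a coded list. -/
def mapCode (f : ℕ → ℕ) (c : ℕ) : ℕ := listCode (((Encodable.decode c).getD [] : List ℕ).map f)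

theorem mapCode_listCode (f : ℕ → ℕ) (l : List ℕ) :
    mapCode f (listCode l) = listCode (l.map f) := by
  simp [mapCode, listCode]

/-- Apply `f` to the second component of pairs with first component `0`. -/
def onZeroTag (f : ℕ → ℕ) (x : ℕ) : ℕ := if x.unpair.1 = 0 then Nat.pair 0 (f x.unpair.2) else x

@[simp] theorem onZeroTag_zero (f : ℕ → ℕ) (x : ℕ) :
    onZeroTag f (Nat.pair 0 x) = Nat.pair 0 (f x) := by
  simp [onZeroTag]

@[simp] theorem onZeroTag_succ (f : ℕ → ℕ) (k x : ℕ) :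
    onZeroTag f (Nat.pair (k + 1) x) = Nat.pair (k + 1) x := by
  simp [onZeroTag]

/-- The effect on codes of formulas of changing the codes of the free variables by `v`. -/
def recode (v : ℕ → ℕ) : ℕ → ℕ :=
  mapCode (onZeroTag fun y => Nat.pair y.unpair.1
    (mapCode (onZeroTag (onZeroTag v)) y.unpair.2))

theorem termCode_recode (g : GoedelCoding L) (enc : α → ℕ) (v : ℕ → ℕ) (t : L.Term α) :
    mapCode (onZeroTag v) (termCode g enc t) = termCode g (v ∘ enc) t := by
  unfold termCode
  rw [mapCode_listCode, List.map_map]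
  congr 2
  funext x
  rcases x with a | p <;> simp

theorem formulaCode_recode (g : GoedelCoding L) (enc : α → ℕ) (v : ℕ → ℕ) {n : ℕ}
    (φ : L.BoundedFormula α n) : recode v (formulaCode g enc φ) = formulaCode g (v ∘ enc) φ := by
  unfold recode formulaCode
  rw [mapCode_listCode, List.map_map]
  congr 2
  funext x
  rcases x with p | q | m
  · simp only [Function.comp_apply, Sum.elim_inl, onZeroTag_zero, Nat.unpair_pair, termCode_recode]
    congr 3
    funext y
    rcases y with a | i <;> simp
  · simp
  · simp

section

variable {σ : Type} [Primcodable σ]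

theorem primrec_mapCode {f : σ → ℕ → ℕ} {c : σ → ℕ} (hf : Primrec₂ f) (hc : Primrec c) :
    Primrec fun a => mapCode (f a) (c a) :=
  Primrec.encode.comp <| Primrec.list_map
    (Primrec.option_getD.comp (Primrec.decode.comp hc) (Primrec.const [])) hf

theorem primrec_onZeroTag {f : σ → ℕ → ℕ} (hf : Primrec₂ f) :
    Primrec₂ fun a => onZeroTag (f a) := by
  have h := Primrec.unpair.comp (Primrec.snd (α := σ) (β := ℕ))
  exact Primrec.ite (Primrec.eq.comp (Primrec.fst.comp h) (Primrec.const 0))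
    (Primrec₂.natPair.comp (Primrec.const 0) (hf.comp Primrec.fst (Primrec.snd.comp h)))
    Primrec.snd

theorem primrec_recode {v : σ → ℕ → ℕ} {c : σ → ℕ} (hv : Primrec₂ v) (hc : Primrec c) :
    Primrec fun a => recode (v a) (c a) := by
  have h := Primrec.unpair.comp (Primrec.snd (α := σ) (β := ℕ))
  refine primrec_mapCode (primrec_onZeroTag ?_) hc
  refine Primrec₂.natPair.comp (Primrec.fst.comp h) ?_
  refine primrec_mapCode ?_ (Primrec.snd.comp h)
  exact primrec_onZeroTag (primrec_onZeroTag (f := fun (a : σ × ℕ) => v a.1)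
    (hv.comp (Primrec.fst.comp Primrec.fst) Primrec.snd))

end

/-- The code of the `a`-th variable, with the first `n` variables singled out. -/
def splitVar (n a : ℕ) : ℕ := if a < n then Nat.pair 0 a else Nat.pair 1 (a - n)

theorem primrec_splitVar : Primrec₂ splitVar :=
  Primrec.ite (Primrec.nat_lt.comp Primrec.snd Primrec.fst)
    (Primrec₂.natPair.comp (Primrec.const 0) Primrec.snd)
    (Primrec₂.natPair.comp (Primrec.const 1) (Primrec.nat_sub.comp Primrec.snd Primrec.fst))

/-- The codes of variables used for formulas with parameters. -/
def sumEnc (n k : ℕ) : Fin n ⊕ Fin k → ℕ :=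
  Sum.elim (fun i : Fin n => Nat.pair 0 i.1) (fun j : Fin k => Nat.pair 1 j.1)

theorem sumEnc_injective (n k : ℕ) : Function.Injective (sumEnc n k) := by
  rintro (a | p) (b | q) e <;> simp only [sumEnc, Sum.elim_inl, Sum.elim_inr] at e
  · exact congrArg _ (Fin.ext (Nat.pair_eq_pair.1 e).2)
  · exact absurd (Nat.pair_eq_pair.1 e).1 (by decide)
  · exact absurd (Nat.pair_eq_pair.1 e).1 (by decide)
  · exact congrArg _ (Fin.ext (Nat.pair_eq_pair.1 e).2)

theorem splitVar_finSumFinEquiv (n k : ℕ) :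
    (splitVar n ∘ Fin.val) ∘ finSumFinEquiv = sumEnc n k := by
  funext x
  rcases x with i | j <;> simp [splitVar, sumEnc]

end Codes

/-! ## Satisfaction in coded structures -/

attribute [local instance] CodedStructure.struc

theorem tupleCode_coe_injective {A : Set ℕ} {n : ℕ} :
    Function.Injective fun a : Fin n → A => tupleCode fun i => (a i : ℕ) := by
  intro a b h
  have := List.ofFn_injective (listCode_injective h)
  exact funext fun i => Subtype.ext (congrFun this i)

theorem mem_elemDiagram {g : GoedelCoding L} {M : CodedStructure L} {k : ℕ}
    {φ : L.Formula (Fin k)} {a : Fin k → M.carrier} :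
    Nat.pair (Nat.pair k (formulaCode g Fin.val φ)) (tupleCode fun i => (a i : ℕ)) ∈
      elemDiagram g M ↔ φ.Realize a := by
  constructor
  · rintro ⟨k', φ', a', e, h⟩
    obtain ⟨e1, e2⟩ := Nat.pair_eq_pair.1 e
    obtain ⟨rfl, e1⟩ := Nat.pair_eq_pair.1 e1
    rw [formulaCode_injective g Fin.val_injective 0 e1, tupleCode_coe_injective e2]
    exact h
  · exact fun h => ⟨k, φ, a, rfl, h⟩

theorem mem_carrier_iff {g : GoedelCoding L} {M : CodedStructure L} {x : ℕ} :
    x ∈ M.carrier ↔ Nat.pair (Nat.pair 1 (formulaCode g Fin.val (⊤ : L.Formula (Fin 1))))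
      (listCode [x]) ∈ elemDiagram g M := by
  constructor
  · intro h
    exact ⟨1, ⊤, fun _ => ⟨x, h⟩, by simp [tupleCode], Formula.realize_top.2 trivial⟩
  · rintro ⟨k', φ', a', e, h⟩
    obtain ⟨e1, e2⟩ := Nat.pair_eq_pair.1 e
    obtain ⟨rfl, e1⟩ := Nat.pair_eq_pair.1 e1
    have := listCode_injective e2
    simp only [List.ofFn_succ, List.ofFn_zero, List.cons.injEq, and_true] at this
    rw [this]
    exact (a' 0).2

theorem ar_carrier {g : GoedelCoding L} {M : CodedStructure L} (h : ArithDecidable g M) :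
    Ar fun x => x ∈ M.carrier := by
  refine ((ar_nat.2 h).comp (f := fun x : ℕ => Nat.pair (Nat.pair 1 (formulaCode g Fin.val
    (⊤ : L.Formula (Fin 1)))) (listCode [x])) ?_).congr fun x => mem_carrier_iff
  exact Primrec₂.natPair.comp (Primrec.const _) (Primrec.encode.comp
    (Primrec.list_cons.comp Primrec.id (Primrec.const [])))

/-- `c` is the code of a formula with parameters from `M` in `n` object variables, satisfied in
`M` by the tuple `u`. -/
def SatCode (g : GoedelCoding L) (M : CodedStructure L) (n c : ℕ) (u : List ℕ) : Prop :=
  ∃ (q : ParamFormula L M n) (b : Fin n → M.carrier), c = pfCode g q ∧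
    u = List.ofFn (fun i => (b i : ℕ)) ∧ q.2.1.Realize (Sum.elim b q.2.2)

theorem pfCode_eq (g : GoedelCoding L) {M : CodedStructure L} {n : ℕ} (q : ParamFormula L M n) :
    pfCode g q = Nat.pair (Nat.pair q.1 (formulaCode g (sumEnc n q.1) q.2.1))
      (tupleCode fun i => (q.2.2 i : ℕ)) := rfl

theorem pfCode_injective (g : GoedelCoding L) {M : CodedStructure L} {n : ℕ} :
    Function.Injective (pfCode g (M := M) (n := n)) := by
  rintro ⟨k, φ, a⟩ ⟨k', φ', a'⟩ e
  replace e := (pfCode_eq g _).symm.trans (e.trans (pfCode_eq g _))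
  obtain ⟨e1, e2⟩ := Nat.pair_eq_pair.1 e
  obtain ⟨e3, e1⟩ := Nat.pair_eq_pair.1 e1
  dsimp only at e3
  subst e3
  have h1 : φ = φ' := formulaCode_injective g (sumEnc_injective n k) 0 e1
  have h2 : a = a' := tupleCode_coe_injective e2
  rw [h1, h2]

theorem satCode_pfCode {g : GoedelCoding L} {M : CodedStructure L} {n : ℕ}
    {q : ParamFormula L M n} {b : Fin n → M.carrier} :
    SatCode g M n (pfCode g q) (List.ofFn fun i => (b i : ℕ)) ↔
      q.2.1.Realize (Sum.elim b q.2.2) := by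
  constructor
  · rintro ⟨q', b', e1, e2, h⟩
    rw [pfCode_injective g e1, tupleCode_coe_injective (congrArg listCode e2)]
    exact h
  · exact fun h => ⟨q, b, rfl, rfl, h⟩

theorem satCode_iff {g : GoedelCoding L} {M : CodedStructure L} {n c : ℕ} {u : List ℕ} :
    SatCode g M n c u ↔ ∃ (f : ℕ) (t : List ℕ),
      c = Nat.pair (Nat.pair t.length (recode (splitVar n) f)) (listCode t) ∧ u.length = n ∧
      Nat.pair (Nat.pair (n + t.length) f) (listCode (u ++ t)) ∈ elemDiagram g M := by
  constructor
  · rintro ⟨⟨k, φ, a⟩, b, rfl, rfl, h⟩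
    refine ⟨formulaCode g Fin.val (rename finSumFinEquiv φ : L.Formula _),
      List.ofFn fun i => (a i : ℕ), ?_, by simp, n + k, rename finSumFinEquiv φ, Fin.append b a,
        ?_, ?_⟩
    · rw [formulaCode_recode, formulaCode_rename, splitVar_finSumFinEquiv, List.length_ofFn]
      rfl
    · rw [List.length_ofFn]
      congr 1
      unfold tupleCode
      rw [← List.ofFn_fin_append]
      congr 2
      funext i
      refine Fin.addCases (fun i => ?_) (fun i => ?_) i <;> simp
    · refine (realize_rename _ _ _).2 ?_
      convert! h using 1
      funext x
      rcases x with i | j <;> simp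
  · rintro ⟨f, t, rfl, rfl, k', φ', a', e, h⟩
    obtain ⟨e1, e2⟩ := Nat.pair_eq_pair.1 e
    obtain ⟨rfl, e1⟩ := Nat.pair_eq_pair.1 e1
    have e3 := listCode_injective e2
    have e4 : (fun i => (a' i : ℕ)) = Fin.append
        (fun i => ((a' (Fin.castAdd _ i) : M.carrier) : ℕ))
        (fun i => ((a' (Fin.natAdd _ i) : M.carrier) : ℕ)) := by
      funext i
      refine Fin.addCases (fun i => ?_) (fun i => ?_) i <;> simp
    rw [e4, List.ofFn_fin_append] at e3
    obtain ⟨e5, e6⟩ := List.append_inj e3 (by simp)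
    refine ⟨⟨t.length, rename finSumFinEquiv.symm φ', fun i => a' (Fin.natAdd _ i)⟩,
      fun i => a' (Fin.castAdd _ i), ?_, e5, ?_⟩
    · refine Eq.trans ?_ (pfCode_eq g _).symm
      rw [e1, formulaCode_recode, formulaCode_rename, ← splitVar_finSumFinEquiv]
      congr 2
      · congr 2
        funext i
        simp
    · refine (realize_rename _ _ _).2 ?_
      convert! h using 1
      funext i
      refine Fin.addCases (fun i => ?_) (fun i => ?_) i <;> simp

theorem ar_satCode {g : GoedelCoding L} {M : CodedStructure L} (h : ArithDecidable g M) :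
    Ar fun x : ℕ × ℕ × List ℕ => SatCode g M x.1 x.2.1 x.2.2 := by
  have hx : Primrec fun x : ((ℕ × ℕ × List ℕ) × ℕ) × List ℕ => x.1.1 :=
    Primrec.fst.comp Primrec.fst
  have hn := Primrec.fst.comp hx
  have hc := Primrec.fst.comp (Primrec.snd.comp hx)
  have hu := Primrec.snd.comp (Primrec.snd.comp hx)
  have hf : Primrec fun x : ((ℕ × ℕ × List ℕ) × ℕ) × List ℕ => x.1.2 :=
    Primrec.snd.comp Primrec.fst
  have ht : Primrec fun x : ((ℕ × ℕ × List ℕ) × ℕ) × List ℕ => x.2 := Primrec.snd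
  have hl := Primrec.list_length.comp ht
  refine Ar.congr (Ar.ex <| Ar.ex <| (Ar.eq hc ?_).and <| (Ar.eq (Primrec.list_length.comp hu)
    hn).and <| (ar_nat.2 h).comp ?_) fun x => satCode_iff
  · exact Primrec₂.natPair.comp (Primrec₂.natPair.comp hl
      (primrec_recode (primrec_splitVar.comp (hn.comp Primrec.fst) Primrec.snd) hf))
      (Primrec.encode.comp ht)
  · exact Primrec₂.natPair.comp (Primrec₂.natPair.comp (Primrec.nat_add.comp hn hl) hf)
      (Primrec.encode.comp (Primrec.list_append.comp hu ht))

/-! ## Coding countable elementary substructures -/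

theorem exists_elementarySubstructure {P : Type} [L.Structure P] (S : Set P)
    (h : ∀ (n : ℕ) (φ : L.Formula (Fin (n + 1))) (x : Fin n → P), (∀ i, x i ∈ S) →
      (∃ a, φ.Realize (Fin.snoc x a : Fin (n + 1) → P)) →
      ∃ b ∈ S, φ.Realize (Fin.snoc x b : Fin (n + 1) → P)) :
    ∃ E : L.ElementarySubstructure P, (E : Set P) = S := by
  let S' : L.Substructure P :=
    { carrier := S
      fun_mem := by
        intro n f x hx
        obtain ⟨b, hb, e⟩ := h n ((Term.var (Fin.last n)).equal
          (Term.func f fun i => Term.var i.castSucc)) x hx ⟨Structure.funMap f x, by simp⟩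
        have : b = Structure.funMap f x := by simpa using e
        exact this ▸ hb }
  refine ⟨S'.toElementarySubstructure fun n φ x a hφ => ?_, rfl⟩
  have key : ∀ y : Fin (n + 1) → P, Formula.Realize
      (rename (Sum.elim Empty.elim id) φ.toFormula : L.Formula (Fin (n + 1))) y ↔
      φ.Realize default y := by
    intro y
    rw [realize_rename, BoundedFormula.realize_toFormula]
    exact iff_of_eq (congrArg₂ _ (Subsingleton.elim _ _) rfl)
  obtain ⟨b, hb, e⟩ := h n _ (fun i => (x i : P)) (fun i => (x i).2) ⟨a, (key _).2 hφ⟩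
  exact ⟨⟨b, hb⟩, (key _).1 e⟩

/-- `c` is the code of a formula true in `P` of the elements of the enumeration `F` with indices
in `l`. -/
def SatIndex (g : GoedelCoding L) {P : Type} [L.Structure P] (F : ℕ → P) (c : ℕ) (l : List ℕ) :
    Prop :=
  ∃ (k : ℕ) (φ : L.Formula (Fin k)) (u : Fin k → ℕ), c = Nat.pair k (formulaCode g Fin.val φ) ∧
    l = List.ofFn u ∧ φ.Realize (F ∘ u)

theorem satIndex_iff {g : GoedelCoding L} {P : Type} [L.Structure P] {F : ℕ → P} {k : ℕ}
    {φ : L.Formula (Fin k)} {u : Fin k → ℕ} :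
    SatIndex g F (Nat.pair k (formulaCode g Fin.val φ)) (List.ofFn u) ↔ φ.Realize (F ∘ u) := by
  constructor
  · rintro ⟨k', φ', u', e1, e2, h⟩
    obtain ⟨rfl, e1⟩ := Nat.pair_eq_pair.1 e1
    rw [formulaCode_injective g Fin.val_injective 0 e1, List.ofFn_injective e2]
    exact h
  · exact fun h => ⟨k, φ, u, rfl, rfl, h⟩

theorem SatIndex.ar_eq {g : GoedelCoding L} {P : Type} [L.Structure P] {F : ℕ → P}
    (hF : Ar fun x : ℕ × List ℕ => SatIndex g F x.1 x.2) :
    Ar fun x : ℕ × ℕ => F x.1 = F x.2 := by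
  refine (hF.comp (f := fun x : ℕ × ℕ => (Nat.pair 2 (formulaCode g Fin.val
    ((Term.var 0).equal (Term.var 1) : L.Formula (Fin 2))), [x.1, x.2])) ?_).congr fun x => ?_
  · exact (Primrec.const _).pair (Primrec.list_cons.comp Primrec.fst
      (Primrec.list_cons.comp Primrec.snd (Primrec.const [])))
  · have := satIndex_iff (g := g) (F := F) (u := ![x.1, x.2])
      (φ := ((Term.var 0).equal (Term.var 1) : L.Formula (Fin 2)))
    rw [show [x.1, x.2] = List.ofFn ![x.1, x.2] by simp, this]
    simp

theorem Ar.list_mem : Ar fun x : ℕ × List ℕ => x.1 ∈ x.2 := by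
  refine (Ar.ex (β := ℕ) (p := fun (x : ℕ × List ℕ) i => x.2[i]? = some x.1) (Ar.eq
    (Primrec.list_getElem?.comp (Primrec.snd.comp Primrec.fst) Primrec.snd)
    (Primrec.option_some.comp (Primrec.fst.comp Primrec.fst)))).congr fun x => ?_
  exact List.mem_iff_getElem?

theorem exists_coded {g : GoedelCoding L} {P : Type} [L.Structure P] {F : ℕ → P}
    (hF : Ar fun x : ℕ × List ℕ => SatIndex g F x.1 x.2) (S : L.ElementarySubstructure P)
    (hS : (S : Set P) = Set.range F) (M : CodedStructure L) (hM : Ar fun x => x ∈ M.carrier)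
    {ι : ℕ → ℕ} (hι : ArF ι)
    (hel : ∀ (k : ℕ) (φ : L.Formula (Fin k)) (a : Fin k → M.carrier),
      φ.Realize a ↔ φ.Realize fun i => F (ι (a i))) :
    ∃ (N : CodedStructure L) (h : ElemSub M N) (j : N.carrier → P), ArithDecidable g N ∧
      (∀ e, ∃ b, j b = F e) ∧ (∀ a : M.carrier, j ⟨a, h.subset a.2⟩ = F (ι a)) ∧
      ∀ (α : Type) (φ : L.Formula α) (v : α → N.carrier), φ.Realize v ↔ φ.Realize (j ∘ v) := by
  classical
  let C : ℕ → Prop := fun x => x ∉ M.carrier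
  have hC : (Set.ofPred C).Infinite := M.compl_infinite
  let New : ℕ → Prop := fun e => (∀ m ∈ M.carrier, F (ι m) ≠ F e) ∧ ∀ e' < e, F e' ≠ F e
  let K : Set ℕ := {x | x ∈ M.carrier ∨
    (C x ∧ Nat.count C x % 2 = 0 ∧ New (Nat.count C x / 2))}
  let κ : ℕ → ℕ := fun x => if x ∈ M.carrier then ι x else Nat.count C x / 2
  have hNewAr : Ar New := by
    have he := SatIndex.ar_eq hF
    refine Ar.and (Ar.all (β := ℕ) (p := fun e m => m ∈ M.carrier → F (ι m) ≠ F e) ?_)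
      (Ar.all (β := ℕ) (p := fun e e' => e' < e → F e' ≠ F e) ?_)
    · exact (hM.comp Primrec.snd).imp (Ar.not (Ar.compF he
        ((hι.comp (.of_primrec Primrec.snd)).pair (.of_primrec Primrec.fst))))
    · exact (Ar.of_primrec (Primrec.nat_lt.comp Primrec.snd Primrec.fst)).imp
        (Ar.not (he.comp (Primrec.snd.pair Primrec.fst)))
  have hcount : ArF (Nat.count C) := ArF.count hM.not
  have hhalf : ArF fun x => Nat.count C x / 2 :=
    (ArF.of_primrec (Primrec.nat_div.comp Primrec.id (Primrec.const 2))).comp hcount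
  have hK : Ar fun x => x ∈ K := by
    refine hM.or (hM.not.and (Ar.and ?_ (hNewAr.compF hhalf)))
    exact Ar.compF (Ar.eq (f := fun x : ℕ => x % 2) (Primrec.nat_mod.comp Primrec.id
      (Primrec.const 2)) (Primrec.const 0)) hcount
  have hκ : ArF κ := ArF.ite hM hι hhalf
  have hcompl : (Kᶜ : Set ℕ).Infinite := by
    refine Set.infinite_of_injective_forall_mem (f := fun e => Nat.nth C (2 * e + 1))
      (fun a b e => ?_) fun e he => ?_
    · have := Nat.nth_injective hC e
      omega
    · have h1 : C (Nat.nth C (2 * e + 1)) := Nat.nth_mem_of_infinite hC _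
      rcases he with he | ⟨-, he, -⟩
      · exact h1 he
      · rw [Nat.count_nth_of_infinite hC] at he
        omega
  have hMM : ∀ x ∈ M.carrier, ∀ y ∈ M.carrier, F (ι x) = F (ι y) → x = y := by
    intro x hx y hy e
    have := (hel 2 ((Term.var 0).equal (Term.var 1)) ![⟨x, hx⟩, ⟨y, hy⟩]).2
      (by simpa using e)
    simpa using this
  have hinj : Function.Injective fun x : K => F (κ x) := by
    rintro ⟨x, hx⟩ ⟨y, hy⟩ e
    refine Subtype.ext ?_
    simp only [κ] at e
    by_cases hxM : x ∈ M.carrier <;> by_cases hyM : y ∈ M.carrier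
    · rw [if_pos hxM, if_pos hyM] at e
      exact hMM x hxM y hyM e
    · rw [if_pos hxM, if_neg hyM] at e
      exact absurd e ((hy.resolve_left hyM).2.2.1 x hxM)
    · rw [if_neg hxM, if_pos hyM] at e
      exact absurd e.symm ((hx.resolve_left hxM).2.2.1 y hyM)
    · rw [if_neg hxM, if_neg hyM] at e
      obtain ⟨-, hx2, -, hxn⟩ := hx.resolve_left hxM
      obtain ⟨-, hy2, -, hyn⟩ := hy.resolve_left hyM
      refine Nat.count_injective (p := C) hxM hyM ?_
      rcases lt_trichotomy (Nat.count C x / 2) (Nat.count C y / 2) with h | h | h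
      · exact absurd e (hyn _ h)
      · dsimp only at h hx2 hy2 ⊢
        omega
      · exact absurd e.symm (hxn _ h)
  have hsurj : ∀ e, ∃ x : K, F (κ x) = F e := by
    intro e
    by_cases hm : ∃ m ∈ M.carrier, F (ι m) = F e
    · obtain ⟨m, hm, h⟩ := hm
      exact ⟨⟨m, Or.inl hm⟩, by simpa [κ, hm] using h⟩
    · have hex : ∃ e', F e' = F e := ⟨e, rfl⟩
      have hmem : C (Nat.nth C (2 * Nat.find hex)) := Nat.nth_mem_of_infinite hC _
      have hcn : Nat.count C (Nat.nth C (2 * Nat.find hex)) = 2 * Nat.find hex :=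
        Nat.count_nth_of_infinite hC _
      have hdiv : 2 * Nat.find hex / 2 = Nat.find hex := by omega
      refine ⟨⟨Nat.nth C (2 * Nat.find hex), Or.inr ⟨hmem, ?_, ?_⟩⟩, ?_⟩
      · omega
      · rw [hcn, hdiv]
        refine ⟨fun m hm' h => hm ⟨m, hm', h.trans (Nat.find_spec hex)⟩, fun e' he' h => ?_⟩
        exact Nat.find_min hex he' (h.trans (Nat.find_spec hex))
      · simp only [κ]
        rw [if_neg hmem, hcn, hdiv]
        exact Nat.find_spec hex
  have hmemS : ∀ x : K, F (κ x) ∈ S := fun x => by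
    rw [← SetLike.mem_coe, hS]
    exact ⟨_, rfl⟩
  let E : K ≃ S := Equiv.ofBijective (fun x => ⟨F (κ x), hmemS x⟩)
    ⟨fun x y e => hinj (congrArg Subtype.val e), fun s => by
      have hs : (s : P) ∈ (S : Set P) := s.2
      rw [hS] at hs
      obtain ⟨e, he⟩ := hs
      obtain ⟨x, hx⟩ := hsurj e
      exact ⟨x, Subtype.ext (hx.trans he)⟩⟩
  let _ : L.Structure K := E.symm.inducedStructure
  let N : CodedStructure L := ⟨K, hcompl, E.symm.inducedStructure⟩
  have hN : ∀ (α : Type) (φ : L.Formula α) (v : α → K),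
      φ.Realize v ↔ φ.Realize ((fun x : K => F (κ x)) ∘ v) := by
    intro α φ v
    have h1 : φ.Realize v ↔ φ.Realize (E ∘ v) := by
      rw [← StrongHomClass.realize_formula E.symm.inducedStructureEquiv φ (v := E ∘ v)]
      refine iff_of_eq (congrArg _ (funext fun i => ?_))
      exact (E.symm_apply_apply (v i)).symm
    exact h1.trans (S.subtype.map_formula φ (E ∘ v)).symm
  have hsub : M.carrier ⊆ K := fun x hx => Or.inl hx
  have hκM : ∀ a : M.carrier, κ a = ι a := fun a => if_pos a.2
  refine ⟨N, ⟨hsub, fun k φ a => ?_⟩, fun x => F (κ x), ?_, hsurj,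
    fun a => congrArg F (hκM a), hN⟩
  · refine (hel k φ a).trans (Iff.trans ?_ (hN _ φ _).symm)
    refine iff_of_eq (congrArg _ (funext fun i => ?_))
    exact congrArg F (hκM (a i)).symm
  · refine ar_nat.1 (Ar.congr (Ar.ex (β := ℕ × List ℕ) (p := fun d y => d = Nat.pair y.1
      (listCode y.2) ∧ (∀ x, x ∈ y.2 → x ∈ K) ∧ SatIndex g F y.1 (y.2.map κ)) ?_) fun d => ?_)
    · refine (Ar.eq Primrec.fst (Primrec₂.natPair.comp (Primrec.fst.comp Primrec.snd)
        (Primrec.encode.comp (Primrec.snd.comp Primrec.snd)))).and (Ar.and ?_ ?_)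
      · exact Ar.all (β := ℕ) (p := fun (z : ℕ × ℕ × List ℕ) x => x ∈ z.2.2 → x ∈ K)
          ((Ar.list_mem.comp (Primrec.snd.pair (Primrec.snd.comp (Primrec.snd.comp
            Primrec.fst)))).imp (hK.comp Primrec.snd))
      · refine hF.compF (f := fun z : ℕ × ℕ × List ℕ => (z.2.1, z.2.2.map κ))
          (ArF.pair (.of_primrec (Primrec.fst.comp Primrec.snd)) ?_)
        exact ArF.list_map (hκ.comp (.of_primrec Primrec.snd))
          (.of_primrec (Primrec.snd.comp Primrec.snd))
    · constructor
      · rintro ⟨k, φ, a, rfl, h⟩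
        refine ⟨(_, List.ofFn fun i => (a i : ℕ)), rfl, fun x hx => ?_, k, φ,
          fun i => κ (a i), rfl, ?_, (hN _ φ a).1 h⟩
        · obtain ⟨i, rfl⟩ := List.mem_ofFn.1 hx
          exact (a i).2
        · exact List.map_ofFn
      · rintro ⟨⟨c, l⟩, rfl, hl, k, φ, u, rfl, e, h⟩
        have hlen : l.length = k := by simpa using congrArg List.length e
        subst hlen
        refine ⟨l.length, φ, fun i => ⟨l[i], hl _ (List.getElem_mem _)⟩, ?_, (hN _ φ _).2 ?_⟩
        · simp [tupleCode]
        · convert! h using 1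
          funext i
          have : κ l[(i : ℕ)] = u i := by simpa using congrArg (fun l => l[(i : ℕ)]?) e
          exact congrArg F this

/-! ## Arithmetically decidable limit extensions -/

theorem lt_listCode {x : ℕ} : ∀ {l : List ℕ}, x ∈ l → x < listCode l := by
  intro l
  induction l with
  | nil => simp
  | cons y l ih =>
    intro h
    have e : listCode (y :: l) = (Nat.pair y (listCode l)).succ := rfl
    rw [e]
    rcases List.mem_cons.1 h with rfl | h
    · exact Nat.lt_succ_of_le (Nat.left_le_pair _ _)
    · exact (ih h).trans_le ((Nat.right_le_pair _ _).trans (Nat.le_succ _))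

/-- The tuple extended by `x` satisfies in `M` the formula with code `c`. -/
def Extends (g : GoedelCoding L) (M : CodedStructure L) (y : ℕ × List ℕ) (x : ℕ) : Prop :=
  Nat.pair y.1 (listCode (y.2 ++ [x])) ∈ elemDiagram g M

theorem Extends.mem {g : GoedelCoding L} {M : CodedStructure L} {y : ℕ × List ℕ} {x : ℕ}
    (h : Extends g M y x) : x ∈ M.carrier := by
  obtain ⟨k, φ, a, e, -⟩ := h
  have : x ∈ List.ofFn fun i => (a i : ℕ) := by
    rw [← listCode_injective (Nat.pair_eq_pair.1 e).2]
    simp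
  obtain ⟨i, rfl⟩ := List.mem_ofFn.1 this
  exact (a i).2

theorem exists_skolem {g : GoedelCoding L} {M : CodedStructure L} (hM : ArithDecidable g M)
    {m₀ : ℕ} (hm₀ : m₀ ∈ M.carrier) :
    ∃ sk : ℕ × List ℕ → ℕ, ArF sk ∧ ∀ y, sk y ∈ M.carrier ∧
      ((∃ x, Extends g M y x) → Extends g M y (sk y)) := by
  have hE : Ar fun z : (ℕ × List ℕ) × ℕ => Extends g M z.1 z.2 :=
    (ar_nat.2 hM).comp (Primrec₂.natPair.comp (Primrec.fst.comp Primrec.fst)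
      (Primrec.encode.comp (Primrec.list_append.comp (Primrec.snd.comp Primrec.fst)
        (Primrec.list_cons.comp Primrec.snd (Primrec.const [])))))
  obtain ⟨sk, h, hsk⟩ := Ar.exists_choice (α := ℕ × List ℕ) (β := ℕ)
    (p := fun y x => x ∈ M.carrier ∧ ((∃ x', Extends g M y x') → Extends g M y x))
    (((ar_carrier hM).comp Primrec.snd).and ((Ar.comp (f := Prod.fst) (Ar.ex hE)
      Primrec.fst).imp hE))
  refine ⟨sk, h, fun y => hsk y ?_⟩
  by_cases hx : ∃ x, Extends g M y x
  · obtain ⟨x, hx⟩ := hx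
    exact ⟨x, hx.mem, fun _ => hx⟩
  · exact ⟨m₀, hm₀, fun h => absurd h hx⟩

open Classical in
/-- One step of the construction of a Skolem closed family of sequences: index `⟨0, y⟩` is the
constant `y`, index `⟨1, y⟩` is the given sequence `B y`, and index `⟨2, ⟨c, l⟩⟩` is the result of
applying the Skolem function for `c` to earlier sequences. -/
noncomputable def skolemStep (K : Set ℕ) (m₀ : ℕ) (B : ℕ → ℕ → ℕ) (sk : ℕ × List ℕ → ℕ) (i : ℕ)
    (prev : List ℕ) : ℕ :=
  if prev.length.unpair.1 = 0 then
    if prev.length.unpair.2 ∈ K then prev.length.unpair.2 else m₀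
  else if prev.length.unpair.1 = 1 then B prev.length.unpair.2 i
  else sk (prev.length.unpair.2.unpair.1,
    ((Encodable.decode prev.length.unpair.2.unpair.2).getD [] : List ℕ).map
      fun j => prev.reverse[j]?.getD m₀)

/-- The Skolem closed family of sequences. -/
noncomputable def skolemSeq (K : Set ℕ) (m₀ : ℕ) (B : ℕ → ℕ → ℕ) (sk : ℕ × List ℕ → ℕ)
    (i e : ℕ) : ℕ :=
  skolemStep K m₀ B sk i (covList (skolemStep K m₀ B sk i) e)

section

variable {K : Set ℕ} {m₀ : ℕ} {B : ℕ → ℕ → ℕ} {sk : ℕ × List ℕ → ℕ}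

open Classical in
theorem ar_skolemSeq (hK : Ar fun x => x ∈ K) (hB : ArF fun x : ℕ × ℕ => B x.1 x.2)
    (hsk : ArF sk) : ArF fun x : ℕ × ℕ => skolemSeq K m₀ B sk x.1 x.2 := by
  refine ArF.cov (G := skolemStep K m₀ B sk) ?_
  have hl : Primrec fun x : ℕ × List ℕ => x.2.length := Primrec.list_length.comp Primrec.snd
  have h1 := Primrec.fst.comp (Primrec.unpair.comp hl)
  have h2 := Primrec.snd.comp (Primrec.unpair.comp hl)
  have h21 := Primrec.fst.comp (Primrec.unpair.comp h2)
  have h22 := Primrec.snd.comp (Primrec.unpair.comp h2)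
  refine ArF.ite (Ar.eq h1 (Primrec.const 0)) (ArF.ite (hK.comp h2) (.of_primrec h2)
    (.of_primrec (Primrec.const m₀))) (ArF.ite (Ar.eq h1 (Primrec.const 1))
      (hB.comp (.of_primrec (h2.pair Primrec.fst))) (hsk.comp (.of_primrec (h21.pair ?_))))
  refine Primrec.list_map (Primrec.option_getD.comp (Primrec.decode.comp h22)
    (Primrec.const [])) ?_
  exact Primrec.option_getD.comp (Primrec.list_getElem?.comp (Primrec.list_reverse.comp
    (Primrec.snd.comp Primrec.fst)) Primrec.snd) (Primrec.const m₀)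

theorem skolemSeq_mem (hm₀ : m₀ ∈ K) (hB : ∀ e i, B e i ∈ K) (hsk : ∀ y, sk y ∈ K) (i e : ℕ) :
    skolemSeq K m₀ B sk i e ∈ K := by
  unfold skolemSeq skolemStep
  split_ifs with h1 h2
  exacts [h2, hm₀, hB _ _, hsk _]

theorem skolemSeq_const {y : ℕ} (hy : y ∈ K) (i : ℕ) :
    skolemSeq K m₀ B sk i (Nat.pair 0 y) = y := by
  simp [skolemSeq, skolemStep, hy]

theorem skolemSeq_base (i y : ℕ) : skolemSeq K m₀ B sk i (Nat.pair 1 y) = B y i := by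
  simp [skolemSeq, skolemStep]

theorem skolemSeq_skolem (i c : ℕ) (l : List ℕ) :
    skolemSeq K m₀ B sk i (Nat.pair 2 (Nat.pair c (listCode l))) =
      sk (c, l.map (skolemSeq K m₀ B sk i)) := by
  have h : ∀ j ∈ l, j < Nat.pair 2 (Nat.pair c (listCode l)) := fun j hj =>
    (lt_listCode hj).trans_le ((Nat.right_le_pair _ _).trans (Nat.right_le_pair _ _))
  generalize he : Nat.pair 2 (Nat.pair c (listCode l)) = e at h
  rw [skolemSeq, skolemStep]
  simp only [length_covList]
  rw [if_neg (by simp [← he]), if_neg (by simp [← he])]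
  simp only [← he, Nat.unpair_pair]
  rw [he]
  simp only [listCode, Encodable.encodek, Option.getD_some]
  refine congrArg (fun l => sk (c, l)) (List.map_congr_left fun j hj => ?_)
  rw [covList_getElem? _ (h j hj)]
  rfl

end

theorem exists_ultrapower (M : Type) [L.Structure M] [Nonempty M] (U : Ultrafilter ℕ) :
    ∃ (P : Type) (_ : L.Structure P) (mk : (ℕ → M) → P), Function.Surjective mk ∧
      ∀ (α : Type) (φ : L.Formula α) (x : α → ℕ → M),
        (φ.Realize fun j => mk (x j)) ↔ ∀ᶠ i in U, φ.Realize fun j => x j i :=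
  ⟨(U : Filter ℕ).Product fun _ => M, inferInstance,
    @Quotient.mk' _ ((U : Filter ℕ).productSetoid fun _ => M), Quotient.mk_surjective,
    fun _ φ x => Ultraproduct.realize_formula_cast φ x⟩

open Filter in
theorem exists_extension {g : GoedelCoding L} {M : CodedStructure L} (hM : ArithDecidable g M)
    {m₀ : ℕ} (hm₀ : m₀ ∈ M.carrier) {B : ℕ → ℕ → ℕ} (hB : ArF fun x : ℕ × ℕ => B x.1 x.2)
    (hBM : ∀ e i, B e i ∈ M.carrier) :
    ∃ (N : CodedStructure L) (h : ElemSub M N) (b : ℕ → N.carrier), ArithDecidable g N ∧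
      ∀ (α β : Type) (φ : L.Formula (α ⊕ β)) (e : α → ℕ) (a : β → M.carrier),
        (∀ᶠ i in atTop, φ.Realize (Sum.elim (fun x => (⟨B (e x) i, hBM _ _⟩ : M.carrier)) a)) →
        φ.Realize (Sum.elim (b ∘ e) fun x => ⟨a x, h.subset (a x).2⟩) := by
  obtain ⟨sk, hsk, hskM⟩ := exists_skolem hM hm₀
  let F : ℕ → ℕ → ℕ := skolemSeq M.carrier m₀ B sk
  have hF : ArF fun x : ℕ × ℕ => F x.1 x.2 := ar_skolemSeq (ar_carrier hM) hB hsk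
  let f : ℕ → ℕ → M.carrier := fun e i =>
    ⟨F i e, skolemSeq_mem hm₀ hBM (fun y => (hskM y).1) i e⟩
  let R : ℕ → ℕ → Prop := fun i n => Nat.pair n.unpair.1
    (listCode (((Encodable.decode n.unpair.2).getD [] : List ℕ).map (F i))) ∈ elemDiagram g M
  have hR : Ar fun x : ℕ × ℕ => R x.1 x.2 := by
    have hu := Primrec.unpair.comp (Primrec.snd (α := ℕ) (β := ℕ))
    refine (ar_nat.2 hM).compF ?_
    refine (ArF.of_primrec (Primrec₂.natPair.comp Primrec.fst Primrec.snd)).comp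
      (ArF.pair (.of_primrec (Primrec.fst.comp hu))
        ((ArF.of_primrec Primrec.encode).comp (ArF.list_map (f := fun (x : ℕ × ℕ) e => F x.1 e) ?_
          (.of_primrec ?_))))
    · exact hF.comp (.of_primrec ((Primrec.fst.comp Primrec.fst).pair Primrec.snd))
    · exact Primrec.option_getD.comp (Primrec.decode.comp (Primrec.snd.comp hu)) (Primrec.const [])
  have hRpair : ∀ i c l, R i (Nat.pair c (listCode l)) ↔
      Nat.pair c (listCode (l.map (F i))) ∈ elemDiagram g M := fun i c l => by
    simp [R, listCode]
  have hRφ : ∀ (i : ℕ) {k : ℕ} (φ : L.Formula (Fin k)) (u : Fin k → ℕ),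
      Nat.pair (Nat.pair k (formulaCode g Fin.val φ)) (listCode ((List.ofFn u).map (F i))) ∈
        elemDiagram g M ↔ φ.Realize fun j => f (u j) i := fun i k φ u => by
    rw [← mem_elemDiagram (g := g), List.map_ofFn]
    rfl
  obtain ⟨U, hU, hUR⟩ := Ar.exists_ultrafilter hR
  have : Nonempty M.carrier := ⟨⟨m₀, hm₀⟩⟩
  obtain ⟨P, _, mk, hmk, hlos⟩ := exists_ultrapower (L := L) M.carrier U
  let FP : ℕ → P := fun e => mk (f e)
  have hlosF : ∀ (α : Type) (φ : L.Formula α) (u : α → ℕ), (φ.Realize fun j => FP (u j)) ↔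
      ∀ᶠ i in U, φ.Realize fun j => f (u j) i := fun α φ u => hlos α φ fun j => f (u j)
  have hsat : Ar fun x : ℕ × List ℕ => SatIndex g FP x.1 x.2 := by
    refine (hUR.comp (f := fun x : ℕ × List ℕ => Nat.pair x.1 (listCode x.2))
      (Primrec₂.natPair.comp Primrec.fst (Primrec.encode.comp Primrec.snd))).congr ?_
    rintro ⟨c, l⟩
    simp only [hRpair]
    constructor
    · rintro ⟨k, φ, u, rfl, rfl, h⟩
      exact ((hlosF _ φ u).1 h).mono fun i hi => (hRφ i φ u).2 hi
    · intro h
      obtain ⟨i, k, φ, a, e, -⟩ := h.exists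
      obtain ⟨rfl, -⟩ := Nat.pair_eq_pair.1 e
      have hl : l.length = k := by
        simpa using congrArg List.length (listCode_injective (Nat.pair_eq_pair.1 e).2)
      obtain ⟨u, rfl⟩ : ∃ u : Fin k → ℕ, l = List.ofFn u :=
        ⟨fun i => l[i], by subst hl; simp⟩
      exact satIndex_iff.2 ((hlosF _ φ u).2 (h.mono fun i hi => (hRφ i φ u).1 hi))
  obtain ⟨S, hS⟩ := exists_elementarySubstructure (L := L) (Set.range FP) (by
    intro n φ x hx ha
    choose u hu using hx
    obtain rfl : (fun i => FP (u i)) = x := funext hu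
    obtain ⟨a, ha⟩ := ha
    obtain ⟨a, rfl⟩ := hmk a
    let e := Nat.pair 2 (Nat.pair (Nat.pair (n + 1) (formulaCode g Fin.val φ))
      (listCode (List.ofFn u)))
    have hsnoc : ∀ a : ℕ → M.carrier,
        (φ.Realize (Fin.snoc (fun i => FP (u i)) (mk a) : Fin (n + 1) → P)) ↔ ∀ᶠ i in U,
          Extends g M (Nat.pair (n + 1) (formulaCode g Fin.val φ),
            (List.ofFn u).map (F i)) (a i) := by
      intro a
      have h1 := hlos _ φ (Fin.snoc (fun j => f (u j)) a : Fin (n + 1) → ℕ → M.carrier)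
      have h2 : (fun j => mk ((Fin.snoc (fun j => f (u j)) a : Fin (n + 1) → ℕ → M.carrier) j)) =
          (Fin.snoc (fun i => FP (u i)) (mk a) : Fin (n + 1) → P) := by
        funext j
        refine Fin.lastCases ?_ (fun j => ?_) j <;> simp [FP]
      rw [h2] at h1
      rw [h1]
      refine eventually_congr (.of_forall fun i => ?_)
      rw [← mem_elemDiagram (g := g), Extends]
      refine iff_of_eq (congrArg (fun l => Nat.pair _ (listCode l) ∈ _) ?_)
      rw [List.ofFn_succ', List.concat_eq_append, List.map_ofFn]
      simp [Function.comp_def, f]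
    refine ⟨FP e, ⟨e, rfl⟩, (hsnoc _).2 (((hsnoc _).1 ha).mono fun i hi => ?_)⟩
    have := (hskM _).2 ⟨_, hi⟩
    rwa [← skolemSeq_skolem (K := M.carrier) (m₀ := m₀) (B := B) (sk := sk)] at this)
  obtain ⟨N, h, j, hN, hj, hjM, hjφ⟩ := exists_coded hsat S hS M (ar_carrier hM)
    (ι := fun m => Nat.pair 0 m)
    (.of_primrec (Primrec₂.natPair.comp (Primrec.const 0) Primrec.id)) (by
      intro k φ a
      rw [hlosF]
      have : ∀ i, (fun x => f (Nat.pair 0 (a x)) i) = a := fun i => funext fun x =>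
        Subtype.ext (skolemSeq_const (a x).2 i)
      simp [this])
  choose b hb using hj
  refine ⟨N, h, fun e => b (Nat.pair 1 e), hN, fun α β φ e a hφ => ?_⟩
  rw [hjφ]
  have : (j ∘ Sum.elim ((fun e => b (Nat.pair 1 e)) ∘ e) fun x => ⟨a x, h.subset (a x).2⟩) =
      fun y => FP (Sum.elim (fun x => Nat.pair 1 (e x)) (fun x => Nat.pair 0 (a x)) y) := by
    funext y
    rcases y with x | x
    · exact hb _
    · exact hjM _
  rw [this, hlosF]
  refine (hφ.filter_mono hU).mono fun i hi => ?_
  convert! hi using 1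
  funext y
  rcases y with x | x
  · exact Subtype.ext (skolemSeq_base i (e x))
  · exact Subtype.ext (skolemSeq_const (a x).2 i)

/-! ## Elementary extensions of coded structures -/

/-- The inclusion of an elementary substructure. -/
def ElemSub.emb {M N : CodedStructure L} (h : ElemSub M N) : M.carrier ↪ₑ[L] N.carrier :=
  ⟨fun x => ⟨x, h.subset x.2⟩, fun _ φ a => (h.elem _ φ a).symm⟩

theorem ElemSub.realize_iff {M N : CodedStructure L} (h : ElemSub M N) {α : Type}
    (φ : L.Formula α) (v : α → M.carrier) : φ.Realize (h.emb ∘ v) ↔ φ.Realize v :=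
  h.emb.map_formula φ v

theorem ElemSub.refl (M : CodedStructure L) : ElemSub M M :=
  ⟨subset_rfl, fun _ _ _ => Iff.rfl⟩

theorem ElemSub.trans {M N K : CodedStructure L} (h : ElemSub M N) (h' : ElemSub N K) :
    ElemSub M K :=
  ⟨h.subset.trans h'.subset, fun k φ a => (h.elem k φ a).trans (h'.elem k φ _)⟩

theorem ElemSub.models_iff {M N : CodedStructure L} (h : ElemSub M N) {T : L.Theory} :
    M.Models T ↔ N.Models T :=
  forall₂_congr fun φ _ => h.emb.map_sentence φ

/-! ## Consistency of types -/

theorem TypeConsistent.mono {M : CodedStructure L} {n : ℕ} {p p' : Set (ParamFormula L M n)}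
    (h : TypeConsistent M p') (hp : p ⊆ p') : TypeConsistent M p := by
  obtain ⟨N, SN, j, b, hb⟩ := h
  exact ⟨N, SN, j, b, fun q hq => hb q (hp hq)⟩

theorem TypeConsistent.exists_realize {M : CodedStructure L} {n : ℕ}
    {p : Set (ParamFormula L M n)} (h : TypeConsistent M p) {s : Set (ParamFormula L M n)}
    (hs : s.Finite) (hsp : s ⊆ p) :
    ∃ b : Fin n → M.carrier, ∀ q ∈ s, q.2.1.Realize (Sum.elim b q.2.2) := by
  obtain ⟨N, SN, j, b, hb⟩ := h
  let j' : M.carrier ↪ₑ[L] N := j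
  have hj : ∀ x, j.fn x = j' x := fun _ => rfl
  let ψ : ParamFormula L M n → L.Formula (M.carrier ⊕ Fin n) := fun q =>
    rename (Sum.elim Sum.inr (Sum.inl ∘ q.2.2)) q.2.1
  have hψ : ∀ {K : Type} [L.Structure K] (i : M.carrier → K) (b : Fin n → K)
      (q : ParamFormula L M n),
      (ψ q).Realize (Sum.elim i b) ↔ q.2.1.Realize (Sum.elim b fun x => i (q.2.2 x)) := by
    intro K _ i b q
    rw [realize_rename]
    refine iff_of_eq (congrArg _ (funext fun x => ?_))
    rcases x with x | x <;> rfl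
  let Ψ : L.Formula (M.carrier ⊕ Fin n) := (hs.toFinset.toList.map ψ).foldr (· ⊓ ·) ⊤
  have hΨ : ∀ {K : Type} [L.Structure K] (v : M.carrier ⊕ Fin n → K),
      Ψ.Realize v ↔ ∀ q ∈ s, (ψ q).Realize v := by
    intro K _ v
    refine (BoundedFormula.realize_foldr_inf _ v default).trans ?_
    simp [Formula.Realize]
  have h1 : (Ψ.iExs (Fin n)).Realize (j' ∘ id) :=
    Formula.realize_iExs.2 ⟨b, (hΨ _).2 fun q hq => (hψ _ b q).2 (hb q (hsp hq))⟩
  obtain ⟨c, hc⟩ := Formula.realize_iExs.1 ((j'.map_formula _ _).1 h1)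
  exact ⟨c, fun q hq => (hψ id c q).1 ((hΨ _).1 hc q hq)⟩

theorem finite_pfCode_le (g : GoedelCoding L) {M : CodedStructure L} {n : ℕ}
    (p : Set (ParamFormula L M n)) (s : ℕ) : {q | q ∈ p ∧ pfCode g q ≤ s}.Finite :=
  ((Set.finite_Iic s).preimage (pfCode_injective g).injOn).subset fun _ h => h.2

theorem typeConsistent_of_forall_finite (g : GoedelCoding L) {M : CodedStructure L}
    [Nonempty M.carrier] {n : ℕ} {p : Set (ParamFormula L M n)}
    (h : ∀ s ⊆ p, s.Finite → ∃ b : Fin n → M.carrier, ∀ q ∈ s,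
      q.2.1.Realize (Sum.elim b q.2.2)) : TypeConsistent M p := by
  choose b hb using fun s => h _ (fun _ h => h.1) (finite_pfCode_le g p s)
  obtain ⟨P, _, mk, -, hlos⟩ := exists_ultrapower (L := L) M.carrier (Filter.hyperfilter ℕ)
  let j : M.carrier ↪ₑ[L] P := ⟨fun x => mk fun _ => x, fun _ φ a =>
    (hlos _ φ fun i _ => a i).trans (by simp)⟩
  refine ⟨P, _, j, fun i => mk fun s => b s i, fun q hq => ?_⟩
  have h1 := hlos _ q.2.1 (Sum.elim (fun i s => b s i) fun x _ => q.2.2 x)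
  have h2 : (fun y => mk ((Sum.elim (fun i s => b s i) fun x _ => q.2.2 x :
      Fin n ⊕ Fin q.1 → ℕ → M.carrier) y)) =
      Sum.elim (fun i => mk fun s => b s i) fun x => j (q.2.2 x) := by
    funext y
    rcases y with x | x <;> rfl
  rw [h2] at h1
  refine h1.2 (((Filter.eventually_ge_atTop (pfCode g q)).filter_mono
    (Nat.hyperfilter_le_atTop)).mono fun s hs => ?_)
  convert! hb s q ⟨hq, hs⟩ using 1
  funext y
  rcases y with x | x <;> rfl

/-- A formula with parameters viewed in an elementary extension. -/
def ParamFormula.up {M N : CodedStructure L} (h : ElemSub M N) {n : ℕ} (q : ParamFormula L M n) :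
    ParamFormula L N n :=
  ⟨q.1, q.2.1, fun i => h.emb (q.2.2 i)⟩

theorem pfCode_up (g : GoedelCoding L) {M N : CodedStructure L} (h : ElemSub M N) {n : ℕ}
    (q : ParamFormula L M n) : pfCode g (q.up h) = pfCode g q := rfl

theorem typeCode_up (g : GoedelCoding L) {M N : CodedStructure L} (h : ElemSub M N) {n : ℕ}
    (p : Set (ParamFormula L M n)) :
    typeCode g (ParamFormula.up h '' p) = typeCode g p := by
  ext c
  simp [typeCode, pfCode_up]

theorem exists_up {M N : CodedStructure L} (h : ElemSub M N) {n : ℕ} (q : ParamFormula L N n)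
    (hq : paramsIn M.carrier q) : ∃ q' : ParamFormula L M n, q'.up h = q :=
  ⟨⟨q.1, q.2.1, fun i => ⟨q.2.2 i, hq i⟩⟩, rfl⟩

theorem TypeConsistent.of_up {M N : CodedStructure L} (h : ElemSub M N) {n : ℕ}
    {p : Set (ParamFormula L M n)} (hp : TypeConsistent N (ParamFormula.up h '' p)) :
    TypeConsistent M p := by
  obtain ⟨K, SK, j, b, hb⟩ := hp
  let j' : N.carrier ↪ₑ[L] K := j
  exact ⟨K, SK, j'.comp h.emb, b, fun q hq => hb _ ⟨q, hq, rfl⟩⟩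

theorem TypeConsistent.up (g : GoedelCoding L) {M N : CodedStructure L} [Nonempty N.carrier]
    (h : ElemSub M N) {n : ℕ} {p : Set (ParamFormula L M n)} (hp : TypeConsistent M p) :
    TypeConsistent N (ParamFormula.up h '' p) := by
  refine typeConsistent_of_forall_finite g fun s hsp hs => ?_
  obtain ⟨s', hs', rfl⟩ := Set.subset_image_iff.1 hsp
  have hinj : Function.Injective (ParamFormula.up (n := n) h) := fun q q' e =>
    pfCode_injective g ((pfCode_up g h q).symm.trans (congrArg (pfCode g) e))
  obtain ⟨b, hb⟩ := hp.exists_realize (hs.of_finite_image hinj.injOn) hs'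
  refine ⟨h.emb ∘ b, ?_⟩
  rintro _ ⟨q, hq, rfl⟩
  convert! (h.realize_iff _ _).2 (hb q hq) using 1
  funext y
  rcases y with x | x <;> rfl

theorem IsNType.up (g : GoedelCoding L) {M N : CodedStructure L} [Nonempty N.carrier]
    (h : ElemSub M N) {A : Set ℕ} (hA : A ⊆ M.carrier) {n : ℕ} {p : Set (ParamFormula L M n)}
    (hp : IsNType M A n p) : IsNType N A n (ParamFormula.up h '' p) := by
  refine ⟨?_, hp.2.1.up g h, fun q hq hqp hc => ?_⟩
  · rintro _ ⟨q, hq, rfl⟩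
    exact hp.1 q hq
  · obtain ⟨q, rfl⟩ := exists_up h q fun i => hA (hq i)
    rw [← Set.image_insert_eq] at hc
    exact hp.2.2 q hq (fun h' => hqp ⟨q, h', rfl⟩) hc.of_up

/-! ## The type of a tuple -/

/-- The type over `A` inside `M` of a tuple from an elementary extension of `M`. -/
def tupleType {M N : CodedStructure L} (h : ElemSub M N) (A : Set ℕ) {n : ℕ}
    (b : Fin n → N.carrier) : Set (ParamFormula L M n) :=
  {q | paramsIn A q ∧ q.2.1.Realize (Sum.elim b fun i => h.emb (q.2.2 i))}

theorem tupleType_consistent {M N : CodedStructure L} (h : ElemSub M N) (A : Set ℕ) {n : ℕ}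
    (b : Fin n → N.carrier) : TypeConsistent M (tupleType h A b) :=
  ⟨N.carrier, N.struc, h.emb, b, fun _ hq => hq.2⟩

theorem isNType_tupleType {M N : CodedStructure L} (h : ElemSub M N) (A : Set ℕ) {n : ℕ}
    (b : Fin n → N.carrier) : IsNType M A n (tupleType h A b) := by
  refine ⟨fun q hq => hq.1, tupleType_consistent h A b, fun q hq hqp hc => ?_⟩
  obtain ⟨K, SK, j, c, hc⟩ := hc
  have h1 : (⟨q.1, q.2.1.not, q.2.2⟩ : ParamFormula L M n) ∈ tupleType h A b :=
    ⟨hq, Formula.realize_not.2 fun h' => hqp ⟨hq, h'⟩⟩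
  exact Formula.realize_not.1 (hc _ (Or.inr h1)) (hc _ (Or.inl rfl))

theorem IsNType.eq_tupleType {M N : CodedStructure L} (h : ElemSub M N) {A : Set ℕ} {n : ℕ}
    {p : Set (ParamFormula L M n)} (hp : IsNType M A n p) {b : Fin n → N.carrier}
    (hb : ∀ q ∈ p, q.2.1.Realize (Sum.elim b fun i => h.emb (q.2.2 i))) :
    p = tupleType h A b := by
  have hsub : p ⊆ tupleType h A b := fun q hq => ⟨hp.1 q hq, hb q hq⟩
  refine hsub.antisymm fun q hq => by_contra fun hqp => hp.2.2 q hq.1 hqp ?_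
  exact (tupleType_consistent h A b).mono (Set.insert_subset hq hsub)

/-- The parameters of the formula with parameters coded by `c`. -/
def codeParams (c : ℕ) : List ℕ := (Encodable.decode c.unpair.2).getD []

theorem codeParams_pfCode (g : GoedelCoding L) {M : CodedStructure L} {n : ℕ}
    (q : ParamFormula L M n) : codeParams (pfCode g q) = List.ofFn fun i => (q.2.2 i : ℕ) := by
  simp [codeParams, pfCode, tupleCode, listCode]

theorem mem_typeCode_tupleType {g : GoedelCoding L} {M N : CodedStructure L} (h : ElemSub M N)
    {A : Set ℕ} (hA : A ⊆ M.carrier) {n : ℕ} (b : Fin n → N.carrier) (c : ℕ) :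
    c ∈ typeCode g (tupleType h A b) ↔
      SatCode g N n c (List.ofFn fun i => (b i : ℕ)) ∧ ∀ x ∈ codeParams c, x ∈ A := by
  constructor
  · rintro ⟨q, ⟨hq, hr⟩, rfl⟩
    rw [codeParams_pfCode, ← pfCode_up g h]
    refine ⟨satCode_pfCode.2 hr, fun x hx => ?_⟩
    obtain ⟨i, rfl⟩ := List.mem_ofFn.1 hx
    exact hq i
  · rintro ⟨⟨q, b', rfl, e, hr⟩, hq⟩
    obtain rfl : b = b' := tupleCode_coe_injective (congrArg listCode e)
    rw [codeParams_pfCode] at hq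
    have hqA : paramsIn A q := fun i => hq _ (List.mem_ofFn.2 ⟨i, rfl⟩)
    obtain ⟨q, rfl⟩ := exists_up h q fun i => hA (hqA i)
    exact ⟨q, ⟨hqA, hr⟩, rfl⟩

/-! ## The characterization -/

open Filter in
/-- Countably many finitely satisfiable sets of formulas, uniformly arithmetically coded, are
realized simultaneously in an arithmetically decidable elementary extension. -/
theorem exists_realizing_extension {g : GoedelCoding L} {M : CodedStructure L}
    [Nonempty M.carrier] (hM : ArithDecidable g M) {X : Set ℕ} (hX : IsArithmetical X) :
    ∃ (N : CodedStructure L) (h : ElemSub M N), ArithDecidable g N ∧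
      ∀ (n t : ℕ) (p : Set (ParamFormula L M n)), TypeConsistent M p →
        tripleSection X n t = typeCode g p →
        ∃ b : Fin n → N.carrier, ∀ q ∈ p,
          q.2.1.Realize (Sum.elim b fun i => h.emb (q.2.2 i)) := by
  classical
  obtain ⟨⟨m₀, hm₀⟩⟩ := ‹Nonempty M.carrier›
  have hK := ar_carrier hM
  let Q : ℕ × ℕ × ℕ → List ℕ → Prop := fun y l => (∀ x, x ∈ l → x ∈ M.carrier) ∧
    ∀ c, c ≤ y.2.2 → Nat.pair y.1 (Nat.pair y.2.1 c) ∈ X → SatCode g M y.1 c l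
  have hQ : Ar fun z : (ℕ × ℕ × ℕ) × List ℕ => Q z.1 z.2 := by
    refine Ar.and (Ar.all (p := fun (z : (ℕ × ℕ × ℕ) × List ℕ) x => x ∈ z.2 → x ∈ M.carrier) ?_)
      (Ar.all (p := fun (z : (ℕ × ℕ × ℕ) × List ℕ) c => c ≤ z.1.2.2 →
        Nat.pair z.1.1 (Nat.pair z.1.2.1 c) ∈ X → SatCode g M z.1.1 c z.2) ?_)
    · exact (Ar.list_mem.comp (Primrec.snd.pair (Primrec.snd.comp Primrec.fst))).imp
        (hK.comp Primrec.snd)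
    · have hy : Primrec fun w : ((ℕ × ℕ × ℕ) × List ℕ) × ℕ => w.1.1 :=
        Primrec.fst.comp Primrec.fst
      have h1 := Primrec.fst.comp hy
      have h21 := Primrec.fst.comp (Primrec.snd.comp hy)
      have h22 := Primrec.snd.comp (Primrec.snd.comp hy)
      refine (Ar.of_primrec (Primrec.nat_le.comp Primrec.snd h22)).imp
        (((ar_nat.2 hX).comp ?_).imp ((ar_satCode hM).comp
          (f := fun w : ((ℕ × ℕ × ℕ) × List ℕ) × ℕ => (w.1.1.1, w.2, w.1.2)) ?_))
      · exact Primrec₂.natPair.comp h1 (Primrec₂.natPair.comp h21 Primrec.snd)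
      · exact h1.pair (Primrec.snd.pair (Primrec.snd.comp Primrec.fst))
  obtain ⟨ch, hch, hchQ⟩ := Ar.exists_choice hQ
  let d : ℕ → ℕ → ℕ := fun e i =>
    (ch (e.unpair.1, e.unpair.2.unpair.1, i))[e.unpair.2.unpair.2]?.getD m₀
  have hd : ArF fun x : ℕ × ℕ => d x.1 x.2 := by
    have hu := Primrec.unpair.comp (Primrec.fst (α := ℕ) (β := ℕ))
    have hv := Primrec.unpair.comp (Primrec.snd.comp hu)
    refine (ArF.of_primrec (f := fun w : List ℕ × ℕ => w.1[w.2]?.getD m₀)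
      (Primrec.option_getD.comp (Primrec.list_getElem?.comp Primrec.fst Primrec.snd)
        (Primrec.const m₀))).comp ((hch.comp (.of_primrec ?_)).pair (.of_primrec ?_))
    · exact (Primrec.fst.comp hu).pair ((Primrec.fst.comp hv).pair Primrec.snd)
    · exact Primrec.snd.comp hv
  let B : ℕ → ℕ → ℕ := fun e i => if d e i ∈ M.carrier then d e i else m₀
  have hB : ArF fun x : ℕ × ℕ => B x.1 x.2 :=
    ArF.ite (hK.compF hd) hd (.of_primrec (Primrec.const m₀))
  have hBM : ∀ e i, B e i ∈ M.carrier := by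
    intro e i
    simp only [B]
    split_ifs with h
    exacts [h, hm₀]
  obtain ⟨N, h, b, hN, hb⟩ := exists_extension hM hm₀ hB hBM
  refine ⟨N, h, hN, fun n t p hp hpX => ?_⟩
  refine ⟨fun j => b (Nat.pair n (Nat.pair t j)), fun q hq => ?_⟩
  refine hb _ _ q.2.1 (fun j : Fin n => Nat.pair n (Nat.pair t j)) q.2.2
    ((eventually_ge_atTop (pfCode g q)).mono fun i hi => ?_)
  have hmem : ∀ c, Nat.pair n (Nat.pair t c) ∈ X ↔ c ∈ typeCode g p := fun c => by
    rw [← hpX]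
    rfl
  have hex : ∃ l, Q (n, t, i) l := by
    obtain ⟨a, ha⟩ := hp.exists_realize (finite_pfCode_le g p i) fun _ h => h.1
    refine ⟨List.ofFn fun j => (a j : ℕ), fun x hx => ?_, fun c hc hcX => ?_⟩
    · obtain ⟨j, rfl⟩ := List.mem_ofFn.1 hx
      exact (a j).2
    · obtain ⟨q', hq', rfl⟩ := (hmem c).1 hcX
      exact satCode_pfCode.2 (ha q' ⟨hq', hc⟩)
  obtain ⟨-, hsat⟩ := hchQ _ hex
  have hq' := hsat _ hi ((hmem _).2 ⟨q, hq, rfl⟩)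
  obtain ⟨-, a, -, ha, -⟩ := id hq'
  rw [ha] at hq'
  convert! satCode_pfCode.1 hq' using 1
  funext y
  rcases y with j | j
  · have hda : d (Nat.pair n (Nat.pair t j)) i = a j := by
      simp only [d, Nat.unpair_pair]
      rw [ha]
      simp
    refine Subtype.ext ?_
    simp only [Sum.elim_inl, B, hda]
    exact if_pos (a j).2
  · rfl

theorem NoFiniteModels.nonempty {T : L.Theory} (hT : NoFiniteModels L T) {M : CodedStructure L}
    (hM : M.Models T) : Nonempty M.carrier :=
  have := hT M.carrier M.struc hM
  inferInstance

theorem isArithmetical_tripleSection {X : Set ℕ} (hX : IsArithmetical X) (n i : ℕ) :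
    IsArithmetical (tripleSection X n i) :=
  ar_nat.1 ((ar_nat.2 hX).comp (f := fun m => Nat.pair n (Nat.pair i m))
    (Primrec₂.natPair.comp (Primrec.const n) (Primrec₂.natPair.comp (Primrec.const i) Primrec.id)))

/-- The types over an arithmetical set of the tuples from an arithmetically decidable elementary
extension are uniformly arithmetical. -/
theorem exists_code_tupleTypes {g : GoedelCoding L} {M N : CodedStructure L} (h : ElemSub M N)
    [Nonempty N.carrier] (hN : ArithDecidable g N) {A : Set ℕ} (hA : A ⊆ M.carrier)
    (hA' : IsArithmetical A) :
    ∃ X, IsArithmetical X ∧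
      (∀ n i, ∃ b : Fin n → N.carrier, tripleSection X n i = typeCode g (tupleType h A b)) ∧
      ∀ n (b : Fin n → N.carrier), ∃ i, tripleSection X n i = typeCode g (tupleType h A b) := by
  classical
  obtain ⟨⟨m₀, hm₀⟩⟩ := ‹Nonempty N.carrier›
  let l : ℕ → List ℕ := fun i => (Encodable.decode i).getD []
  have hl : Primrec l := Primrec.option_getD.comp Primrec.decode (Primrec.const [])
  let Good : ℕ × ℕ → Prop := fun y => (l y.2).length = y.1 ∧ ∀ x, x ∈ l y.2 → x ∈ N.carrier
  let u : ℕ × ℕ → List ℕ := fun y => if Good y then l y.2 else List.replicate y.1 m₀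
  have hGood : Ar Good :=
    (Ar.eq (Primrec.list_length.comp (hl.comp Primrec.snd)) Primrec.fst).and <|
      Ar.all (p := fun (y : ℕ × ℕ) x => x ∈ l y.2 → x ∈ N.carrier)
        ((Ar.list_mem.comp (Primrec.snd.pair (hl.comp (Primrec.snd.comp Primrec.fst)))).imp
          ((ar_carrier hN).comp Primrec.snd))
  have hrep : Primrec fun y : ℕ × ℕ => List.replicate y.1 m₀ := by
    refine (Primrec.list_map (Primrec.list_range.comp Primrec.fst)
      (Primrec.const m₀).to₂).of_eq fun y => ?_
    simp
  have hu : ArF u := ArF.ite hGood (.of_primrec (hl.comp Primrec.snd)) (.of_primrec hrep)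
  have hex : ∀ n i, ∃ b : Fin n → N.carrier, u (n, i) = List.ofFn fun j => (b j : ℕ) := by
    intro n i
    by_cases hg : Good (n, i)
    · obtain ⟨hlen, hmem⟩ := id hg
      refine ⟨fun j => ⟨(l i)[(j : ℕ)]'(by dsimp only at hlen; omega),
        hmem _ (List.getElem_mem _)⟩, ?_⟩
      simp only [u, if_pos hg]
      dsimp only at hlen
      subst hlen
      simp
    · refine ⟨fun _ => ⟨m₀, hm₀⟩, ?_⟩
      simp only [u, if_neg hg]
      simp
  let S : ℕ × ℕ × ℕ → Prop := fun z =>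
    SatCode g N z.1 z.2.2 (u (z.1, z.2.1)) ∧ ∀ x, x ∈ codeParams z.2.2 → x ∈ A
  have hparams : Primrec codeParams :=
    Primrec.option_getD.comp (Primrec.decode.comp (Primrec.snd.comp Primrec.unpair))
      (Primrec.const [])
  have hS : Ar S := by
    have h1 : Primrec fun z : ℕ × ℕ × ℕ => z.1 := Primrec.fst
    have h21 : Primrec fun z : ℕ × ℕ × ℕ => z.2.1 := Primrec.fst.comp Primrec.snd
    have h22 : Primrec fun z : ℕ × ℕ × ℕ => z.2.2 := Primrec.snd.comp Primrec.snd
    refine ((ar_satCode hN).compF (f := fun z : ℕ × ℕ × ℕ => (z.1, z.2.2, u (z.1, z.2.1)))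
      ((ArF.of_primrec h1).pair ((ArF.of_primrec h22).pair
        (hu.comp (.of_primrec (h1.pair h21)))))).and ?_
    exact Ar.all (p := fun (z : ℕ × ℕ × ℕ) x => x ∈ codeParams z.2.2 → x ∈ A)
      ((Ar.list_mem.comp (Primrec.snd.pair (hparams.comp (h22.comp Primrec.fst)))).imp
        ((ar_nat.2 hA').comp Primrec.snd))
  let X : Set ℕ := {x | S (x.unpair.1, x.unpair.2.unpair.1, x.unpair.2.unpair.2)}
  have hX : IsArithmetical X := by
    refine ar_nat.1 (hS.comp ?_)
    have hv := Primrec.unpair.comp (Primrec.snd.comp Primrec.unpair)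
    exact (Primrec.fst.comp Primrec.unpair).pair ((Primrec.fst.comp hv).pair (Primrec.snd.comp hv))
  have hsec : ∀ n i (b : Fin n → N.carrier), u (n, i) = List.ofFn (fun j => (b j : ℕ)) →
      tripleSection X n i = typeCode g (tupleType h A b) := by
    intro n i b hb
    ext c
    rw [mem_typeCode_tupleType h hA, ← hb]
    simp [tripleSection, X, S]
  refine ⟨X, hX, fun n i => ?_, fun n b => ⟨listCode (List.ofFn fun j => (b j : ℕ)), ?_⟩⟩
  · obtain ⟨b, hb⟩ := hex n i
    exact ⟨b, hsec n i b hb⟩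
  · refine hsec _ _ b ?_
    have hl' : l (listCode (List.ofFn fun j => (b j : ℕ))) = List.ofFn fun j => (b j : ℕ) := by
      simp [l, listCode]
    refine (if_pos ⟨?_, ?_⟩).trans hl'
    · simp [hl']
    · intro x hx
      rw [hl'] at hx
      obtain ⟨j, rfl⟩ := List.mem_ofFn.1 hx
      exact (b j).2

/-- **Realization characterization of arithmetical stability.** -/
theorem stability_realization_characterization
    (L : FirstOrder.Language) (g : GoedelCoding L) (hL : ArithLang g)
    (T : L.Theory) (hT : ArithTheory g T) (hcomp : T.IsComplete)
    (hnf : NoFiniteModels L T) :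
    ArithStable g T ↔
      ∀ M : CodedStructure L, M.Models T → ArithExtendible g T M →
        ∀ A : Set ℕ, A ⊆ M.carrier → IsArithmetical A →
          ∃ (N : CodedStructure L) (h : ElemSub M N),
            N.Models T ∧ ArithExtendible g T N ∧
            ∀ n : ℕ, 1 ≤ n → ∀ p : Set (ParamFormula L M n),
              IsNType M A n p → IsArithmetical (typeCode g p) →
              RealizesType h.subset p := by
  constructor
  · rintro hst M - ⟨K, hK, hKT, hMK⟩ A hA hA'
    have := hnf.nonempty hKT
    obtain ⟨X, hX, -, hall⟩ := hst K hK hKT A (hA.trans hMK.subset) hA'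
    obtain ⟨N, hKN, hN, hreal⟩ := exists_realizing_extension hK hX
    have hNT := hKN.models_iff.1 hKT
    refine ⟨N, hMK.trans hKN, hNT, ⟨N, hN, hNT, .refl N⟩, fun n hn p hp hpA => ?_⟩
    have hp' := hp.up g hMK hA
    rw [← typeCode_up g hMK] at hpA
    obtain ⟨t, ht⟩ := hall n hn _ hp' hpA
    obtain ⟨b, hb⟩ := hreal n t _ hp'.2.1 ht
    exact ⟨b, fun q hq => hb _ ⟨q, hq, rfl⟩⟩
  · intro hreal M hM hMT A hA hA'
    obtain ⟨N, hMN, -, ⟨K, hK, hKT, hNK⟩, hN⟩ := hreal M hMT ⟨M, hM, hMT, .refl M⟩ A hA hA'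
    have := hnf.nonempty hKT
    obtain ⟨X, hX, hsec, hall⟩ := exists_code_tupleTypes (hMN.trans hNK) hK hA hA'
    refine ⟨X, hX, fun n _ i => ?_, fun n hn p hp hpA => ?_⟩
    · obtain ⟨b, hb⟩ := hsec n i
      exact ⟨_, isNType_tupleType _ A b, hb ▸ isArithmetical_tripleSection hX n i, hb⟩
    · obtain ⟨b, hb⟩ := hN n hn p hp hpA
      have hp' : p = tupleType (hMN.trans hNK) A (hNK.emb ∘ b) := hp.eq_tupleType _ fun q hq => by
        convert! (hNK.realize_iff _ _).2 (hb q hq) using 1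
        funext y
        rcases y with x | x <;> rfl
      rw [hp']
      exact hall n _

end ArMorley
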